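/- Let P be a non-symmetric operad over K and m ∈ P(2). Then m is a multiplication on P, i.e. γ(m; m, id_P) = γ(m; id_P, m), if and only if m{m} = 0 in W_P. In that case, defining on W_P the cup product x ∪ y := (−1)^{|x|} m{x, y} and the differential δ(x) := m{x} − (−1)^{|x|+1} x{m}, the quadruple (W_P, δ, ∪, braces) is a brace B∞ algebra. -/

import Mathlib

/-! # Preliminaries: graded brace algebras and brace `B∞` algebras -/

noncomputable section

open scoped TensorProduct

universe u

/-- The sign `(-1)^t` in a field `K`, for an integer exponent `t`. -/
def sgn (K : Type u) [Field K] (t : ℤ) : K := ((((-1 : Kˣ)) ^ t : Kˣ) : K)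

namespace BraceCombinatorics

/-- The index set appearing in the higher pre-Jacobi identities: sequences
`i₁, …, i_n`, `r₁, …, r_n` with `i_p + r_p ≤ i_q` for `p < q` and `i_p + r_p ≤ m`. -/
def InsData (n m : ℕ) : Type :=
  {ir : (Fin n → Fin (m + 1)) × (Fin n → Fin (m + 1)) //
    (∀ a b : Fin n, a < b → (ir.1 a : ℕ) + (ir.2 a : ℕ) ≤ (ir.1 b : ℕ)) ∧
    ∀ a : Fin n, (ir.1 a : ℕ) + (ir.2 a : ℕ) ≤ m}

instance (n m : ℕ) : Fintype (InsData n m) := by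
  unfold InsData; infer_instance

/-- The position, in the output list of the pre-Jacobi right-hand side, at which the
`p`-th inner brace `y_p{z_{i_p+1}, …, z_{i_p+r_p}}` is placed. -/
def oPos {n m : ℕ} (ins : InsData n m) (p : Fin n) : ℕ :=
  (ins.1.1 p : ℕ) + (p : ℕ) - ∑ a ∈ Finset.univ.filter (fun a : Fin n => a < p), (ins.1.2 a : ℕ)

/-- The list of arguments `z₁, …, z_{i₁}, y₁{z_{i₁+1},…,z_{i₁+r₁}}, …, z_m` appearing on the
right-hand side of the higher pre-Jacobi identity. -/
def insArgs {W : Type u} [AddCommGroup W]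
    (μf : ∀ k : ℕ, W → (Fin k → W) → W) {n m : ℕ} (ins : InsData n m)
    (y : Fin n → W) (z : Fin m → W) :
    Fin (n + m - ∑ a : Fin n, (ins.1.2 a : ℕ)) → W := fun t =>
  if h : ∃ p : Fin n, oPos ins p = (t : ℕ) then
    μf ((ins.1.2 h.choose : ℕ)) (y h.choose)
      (fun s : Fin ((ins.1.2 h.choose : ℕ)) =>
        z ⟨(ins.1.1 h.choose : ℕ) + (s : ℕ), by
          have h1 := ins.2.2 h.choose
          have h2 := s.isLt
          omega⟩)
  else
    let idx : ℕ := (t : ℕ)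
        - (Finset.univ.filter (fun p : Fin n => oPos ins p < (t : ℕ))).card
        + ∑ p ∈ Finset.univ.filter (fun p : Fin n => oPos ins p < (t : ℕ)), (ins.1.2 p : ℕ)
    if hx : idx < m then z ⟨idx, hx⟩ else 0

/-- The sign exponent `∑_{p=1}^n (|y_p|+1) · ∑_{q=1}^{i_p} (|z_q|+1)` of the pre-Jacobi
identity. -/
def insExp {n m : ℕ} (ins : InsData n m) (e : Fin n → ℤ) (f : Fin m → ℤ) : ℤ :=
  ∑ p : Fin n, (e p + 1) *
    ∑ q ∈ Finset.univ.filter (fun q : Fin m => (q : ℕ) < (ins.1.1 p : ℕ)), (f q + 1)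

end BraceCombinatorics

open BraceCombinatorics

/-- The higher pre-Jacobi identities for a family of brace operations `μf` on a graded
vector space with grading `P`. -/
def IsPreJacobi {K : Type u} [Field K] {W : Type u} [AddCommGroup W] [Module K W]
    (μf : ∀ k : ℕ, W → (Fin k → W) → W) (P : ℤ → Submodule K W) : Prop :=
  ∀ (n m : ℕ) (d : ℤ) (e : Fin n → ℤ) (f : Fin m → ℤ)
    (x : W) (y : Fin n → W) (z : Fin m → W),
    x ∈ P d → (∀ a, y a ∈ P (e a)) → (∀ b, z b ∈ P (f b)) →
    μf m (μf n x y) z =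
      ∑ ins : InsData n m, sgn K (insExp ins e f) • μf _ x (insArgs μf ins y z)

/-- A brace algebra: a `ℤ`-graded `K`-vector space `W` with `K`-multilinear brace
operations `μ k : W ⊗ (W[1])^{⊗k} → W`, `x{x₁,…,x_k} := μ k x (x₁,…,x_k)`, such that
`x{} = x` and the higher pre-Jacobi identities hold. -/
structure BraceAlg (K : Type u) [Field K] (W : Type u) [AddCommGroup W] [Module K W] :
    Type u where
  /-- the grading of `W` -/
  grading : ℤ → Submodule K W
  /-- `W` is the (internal) direct sum of its homogeneous components -/
  decomp : DirectSum.IsInternal grading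
  /-- the brace operations -/
  μ : ∀ k : ℕ, W →ₗ[K] MultilinearMap K (fun _ : Fin k => W) W
  /-- braces are degree-`0` maps `W ⊗ (W[1])^{⊗ k} → W` -/
  μ_grade : ∀ {k : ℕ} (d : ℤ) (e : Fin k → ℤ) (x : W) (y : Fin k → W),
    x ∈ grading d → (∀ i, y i ∈ grading (e i)) →
    μ k x y ∈ grading (d + ∑ i, (e i - 1))
  /-- `x{} = x` -/
  μ_zero : ∀ x : W, μ 0 x ![] = x
  /-- the higher pre-Jacobi identities -/
  pre_jacobi : IsPreJacobi (fun k x y => μ k x y) grading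

/-- A brace `B∞` algebra: a brace algebra together with a degree `+1` differential `d`
and a degree `0` associative product, satisfying the Leibniz rule, the distributivity
relations and the higher homotopy relations. -/
structure BraceBInfty (K : Type u) [Field K] (W : Type u) [AddCommGroup W] [Module K W]
    extends BraceAlg K W where
  /-- the differential -/
  d : W →ₗ[K] W
  /-- the associative product -/
  mul : W →ₗ[K] W →ₗ[K] W
  d_grade : ∀ (a : ℤ) (x : W), x ∈ grading a → d x ∈ grading (a + 1)
  mul_grade : ∀ (a b : ℤ) (x y : W), x ∈ grading a → y ∈ grading b →
    mul x y ∈ grading (a + b)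
  d_sq : ∀ x : W, d (d x) = 0
  mul_assoc' : ∀ x y z : W, mul (mul x y) z = mul x (mul y z)
  leibniz : ∀ (a : ℤ) (x y : W), x ∈ grading a →
    d (mul x y) = mul (d x) y + sgn K a • mul x (d y)
  /-- the distributivity relations -/
  distrib : ∀ (n : ℕ) (b : ℤ) (f : Fin n → ℤ) (x₁ x₂ : W) (y : Fin n → W),
    x₂ ∈ grading b → (∀ i, y i ∈ grading (f i)) →
    μ n (mul x₁ x₂) y =
      ∑ k : Fin (n + 1),
        sgn K (b * ∑ p ∈ Finset.univ.filter (fun p : Fin n => (p : ℕ) < (k : ℕ)), (f p + 1)) •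
          mul (μ (k : ℕ) x₁ (fun i : Fin (k : ℕ) => y (Fin.castLE (Nat.lt_succ_iff.mp k.isLt) i)))
              (μ (n - (k : ℕ)) x₂ (fun i : Fin (n - (k : ℕ)) =>
                y ⟨(k : ℕ) + (i : ℕ), by have := i.isLt; omega⟩))
  /-- the higher homotopies -/
  homotopy : ∀ (n : ℕ) (a : ℤ) (f : Fin (n + 1) → ℤ) (x : W) (xs : Fin (n + 1) → W),
    x ∈ grading a → (∀ i, xs i ∈ grading (f i)) →
    d (μ (n + 1) x xs) - μ (n + 1) (d x) xs
      - ∑ i : Fin (n + 1),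
          sgn K (a + 1 + ∑ j ∈ Finset.univ.filter (fun j : Fin (n + 1) => (j : ℕ) < (i : ℕ)), (f j + 1)) •
            μ (n + 1) x (Function.update xs i (d (xs i)))
    = sgn K (a * (f 0 + 1)) • mul (xs 0) (μ n x (fun i : Fin n => xs i.succ))
      - ∑ i : Fin n,
          sgn K (a + 1 + ∑ j ∈ Finset.univ.filter (fun j : Fin (n + 1) => (j : ℕ) ≤ (i : ℕ)), (f j + 1)) •
            μ n x (fun t : Fin n =>
              if (t : ℕ) < (i : ℕ) then xs t.castSucc
              else if (t : ℕ) = (i : ℕ) then mul (xs t.castSucc) (xs t.succ)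
              else xs t.succ)
      + sgn K (a + 1 + ∑ j ∈ Finset.univ.filter (fun j : Fin (n + 1) => (j : ℕ) < n), (f j + 1)) •
          mul (μ n x (fun i : Fin n => xs i.castSucc)) (xs (Fin.last n))

/-- A strict `B∞` morphism between brace `B∞` algebras: a degree-preserving linear map
commuting with the differentials, the products, and all brace operations. -/
structure IsStrictBInftyHom {K : Type u} [Field K]
    {W₁ : Type u} [AddCommGroup W₁] [Module K W₁]
    {W₂ : Type u} [AddCommGroup W₂] [Module K W₂]
    (B₁ : BraceBInfty K W₁) (B₂ : BraceBInfty K W₂) (F : W₁ →ₗ[K] W₂) : Prop where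
  grade : ∀ (a : ℤ) (x : W₁), x ∈ B₁.grading a → F x ∈ B₂.grading a
  comm_d : ∀ x, F (B₁.d x) = B₂.d (F x)
  comm_mul : ∀ x y, F (B₁.mul x y) = B₂.mul (F x) (F y)
  comm_μ : ∀ (k : ℕ) (x : W₁) (y : Fin k → W₁),
    F (B₁.μ k x y) = B₂.μ k (F x) (fun i => F (y i))

/-! ## Non-symmetric operads -/

/-- A non-symmetric operad over `K`, presented by its total space `A = ⊕ₙ P(n)` with the
grading `P`, the identity element `id_P ∈ P(1)`, and the (bilinear) partial composition
maps `comp i x y = x ∘_{i+1} y` (`0`-indexed), subject to the sequential and parallel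
composition axioms and the unitality axiom. -/
structure NsOperad (K : Type u) [Field K] (A : Type u) [AddCommGroup A] [Module K A] :
    Type u where
  grading : ℕ → Submodule K A
  decomp : DirectSum.IsInternal grading
  /-- the operadic identity. -/
  idp : A
  idp_grade : idp ∈ grading 1
  /-- `comp i x y` is the partial composition `x ∘_{i+1} y` (`0`-indexed slot `i`). -/
  comp : ℕ → A →ₗ[K] A →ₗ[K] A
  comp_grade : ∀ {n m : ℕ} (i : ℕ), i < n → ∀ x ∈ grading n, ∀ y ∈ grading m,
    comp i x y ∈ grading (n + m - 1)
  /-- the sequential composition axiom -/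
  seq : ∀ {n m l : ℕ} (i j : ℕ), i < n → j < m →
    ∀ x ∈ grading n, ∀ y ∈ grading m, ∀ z ∈ grading l,
    comp (i + j) (comp i x y) z = comp i x (comp j y z)
  /-- the parallel composition axiom -/
  par : ∀ {n m l : ℕ} (i k : ℕ), i < k → k < n →
    ∀ x ∈ grading n, ∀ y ∈ grading m, ∀ z ∈ grading l,
    comp (k + m - 1) (comp i x y) z = comp i (comp k x z) y
  /-- the unitality axiom, left -/
  unit_left : ∀ x : A, comp 0 idp x = x
  /-- the unitality axiom, right -/
  unit_right : ∀ {n : ℕ} (i : ℕ), i < n → ∀ x ∈ grading n, comp i x idp = x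

namespace NsOperad

variable {K : Type u} [Field K] {A : Type u} [AddCommGroup A] [Module K A]

/-- Iterated insertion `(⋯(x ∘_{j_k} y_k) ∘_{j_{k-1}} y_{k-1} ⋯) ∘_{j₁} y₁`
(inserting at the last position first). -/
def multiIns (O : NsOperad K A) : ∀ k : ℕ, A → (Fin k → ℕ) → (Fin k → A) → A
  | 0, x, _, _ => x
  | (k + 1), x, j, y =>
      O.multiIns k (O.comp (j (Fin.last k)) x (y (Fin.last k)))
        (fun l => j l.castSucc) (fun l => y l.castSucc)

open Classical in
/-- The operadic brace operations `x{y₁,…,y_k}` on `W_P = ⊕ₙ P(n)[-n]`, for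
`x` of degree `p` and `y_l` of degree `q l`: the sum over all order-preserving insertions
of `y₁,…,y_k` into the `p` inputs of `x`, with the Gerstenhaber–Voronov signs. -/
def brace (O : NsOperad K A) (p : ℕ) {k : ℕ} (q : Fin k → ℕ) (x : A) (y : Fin k → A) : A :=
  ∑ j ∈ Finset.univ.filter (fun j : Fin k → Fin p => StrictMono j),
    sgn K (∑ l : Fin k,
        (((j l : ℕ) : ℤ) - ((l : ℕ) : ℤ) +
          ∑ r ∈ Finset.univ.filter (fun r : Fin k => r < l), ((q r : ℕ) : ℤ)) *
        (((q l : ℕ) : ℤ) - 1)) •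
      O.multiIns k x (fun l => (j l : ℕ)) y

end NsOperad
section Core

set_option linter.unusedSectionVars false

theorem sgn_congr (K : Type u) [Field K] {a b : ℤ} (h : (a : ZMod 2) = (b : ZMod 2)) :
    sgn K a = sgn K b := by
  have h2 : Even (a - b) := by
    rw [← ZMod.intCast_eq_zero_iff_even]; push_cast; rw [h, sub_self]
  unfold sgn
  congr 1
  have : a = b + (a - b) := by ring
  rw [this, zpow_add, h2.neg_one_zpow, mul_one]

theorem sgn_add (K : Type u) [Field K] (a b : ℤ) : sgn K (a + b) = sgn K a * sgn K b := by
  unfold sgn; rw [zpow_add]; simp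

@[simp] theorem sgn_zero (K : Type u) [Field K] : sgn K 0 = 1 := by simp [sgn]
theorem sgn_one (K : Type u) [Field K] : sgn K 1 = -1 := by simp [sgn]
theorem sgn_neg_smul (K : Type u) [Field K] {A : Type u} [AddCommGroup A] [Module K A] (t : ℤ) (x : A) :
    - (sgn K t • x) = sgn K (t + 1) • x := by
  rw [sgn_add, sgn_one]; simp
theorem sgn_smul_smul (K : Type u) [Field K] {A : Type u} [AddCommGroup A] [Module K A] (a b : ℤ) (x : A) :
    sgn K a • sgn K b • x = sgn K (a + b) • x := by
  rw [sgn_add, mul_smul]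

variable {K : Type u} [Field K] {A : Type u} [AddCommGroup A] [Module K A]

namespace NsOperad

variable (O : NsOperad K A)

/-- integer grading -/
def gz : ℤ → Submodule K A
  | Int.ofNat n => O.grading n
  | Int.negSucc _ => ⊥

theorem gz_natCast (n : ℕ) : O.gz (n : ℤ) = O.grading n := rfl

theorem gz_neg {z : ℤ} (h : z < 0) : O.gz z = ⊥ := by
  cases z with
  | ofNat n => simp at h; omega
  | negSucc n => rfl

theorem gz_cases {z : ℤ} {x : A} (h : x ∈ O.gz z) : x = 0 ∨ ∃ n : ℕ, z = n ∧ x ∈ O.grading n := by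
  cases z with
  | ofNat n => exact Or.inr ⟨n, rfl, h⟩
  | negSucc n => left; simpa [gz] using h

theorem gz_of {n : ℕ} {z : ℤ} {x : A} (h : x ∈ O.grading n) (hz : z = n) : x ∈ O.gz z := by
  subst hz; exact h

theorem comp_gz {p q : ℤ} {x y : A} (i : ℕ) (hi : (i : ℤ) < p) (hx : x ∈ O.gz p)
    (hy : y ∈ O.gz q) : O.comp i x y ∈ O.gz (p + q - 1) := by
  rcases O.gz_cases hx with rfl | ⟨n, rfl, hx⟩
  · simp
  rcases O.gz_cases hy with rfl | ⟨m, rfl, hy⟩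
  · simp
  exact O.gz_of (O.comp_grade i (by omega) x hx y hy) (by omega)

theorem par_gz {n m l : ℤ} {x y z : A} (i k k' : ℕ) (hik : i < k) (hk : (k : ℤ) < n)
    (hk' : (k' : ℤ) = k + m - 1) (hx : x ∈ O.gz n) (hy : y ∈ O.gz m) (hz : z ∈ O.gz l) :
    O.comp k' (O.comp i x y) z = O.comp i (O.comp k x z) y := by
  rcases O.gz_cases hx with rfl | ⟨n, rfl, hx⟩
  · simp
  rcases O.gz_cases hy with rfl | ⟨m, rfl, hy⟩
  · simp
  rcases O.gz_cases hz with rfl | ⟨l, rfl, hz⟩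
  · simp
  have : k' = k + m - 1 := by omega
  subst this
  exact O.par i k hik (by omega) x hx y hy z hz

theorem seq_gz {n m l : ℤ} {x y z : A} (i j : ℕ) (hi : (i : ℤ) < n) (hj : (j : ℤ) < m)
    (hx : x ∈ O.gz n) (hy : y ∈ O.gz m) (hz : z ∈ O.gz l) :
    O.comp (i + j) (O.comp i x y) z = O.comp i x (O.comp j y z) := by
  rcases O.gz_cases hx with rfl | ⟨n, rfl, hx⟩
  · simp
  rcases O.gz_cases hy with rfl | ⟨m, rfl, hy⟩
  · simp
  rcases O.gz_cases hz with rfl | ⟨l, rfl, hz⟩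
  · simp
  exact O.seq i j (by omega) (by omega) x hx y hy z hz

/-- total shifted degree -/
def sd (L : List (ℤ × A)) : ℤ := (L.map (fun e => e.1 - 1)).sum

@[simp] theorem sd_nil : sd ([] : List (ℤ × A)) = 0 := rfl
@[simp] theorem sd_cons (e : ℤ × A) (L : List (ℤ × A)) : sd (e :: L) = (e.1 - 1) + sd L := by
  simp [sd]
@[simp] theorem sd_append (L M : List (ℤ × A)) : sd (L ++ M) = sd L + sd M := by
  simp [sd]
@[simp] theorem sd_reverse (L : List (ℤ × A)) : sd L.reverse = sd L := by
  simp [sd, List.sum_reverse]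

/-- insert the (reversed) list in the slots `o, …, o+r-1` -/
def U (o : ℕ) : ℕ → A → List (ℤ × A) → A
  | _, x, [] => x
  | 0, _, _ :: _ => 0
  | r + 1, x, e :: L => U o r x (e :: L) +
      sgn K (((o : ℤ) + r + sd L) * (e.1 - 1)) • U o r (O.comp (o + r) x e.2) L

@[simp] theorem U_nil (o r : ℕ) (x : A) : O.U o r x [] = x := by cases r <;> rfl
@[simp] theorem U_zero_cons (o : ℕ) (x : A) (e : ℤ × A) (L) : O.U o 0 x (e :: L) = 0 := rfl
theorem U_succ (o r : ℕ) (x : A) (e : ℤ × A) (L) : O.U o (r + 1) x (e :: L) = O.U o r x (e :: L) +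
      sgn K (((o : ℤ) + r + sd L) * (e.1 - 1)) • O.U o r (O.comp (o + r) x e.2) L := rfl

/-- homogeneous lists -/
def HL (L : List (ℤ × A)) : Prop := ∀ e ∈ L, e.2 ∈ O.gz e.1

theorem HL_nil : O.HL [] := by simp [HL]
theorem HL_cons {e : ℤ × A} {L} : O.HL (e :: L) ↔ e.2 ∈ O.gz e.1 ∧ O.HL L := by simp [HL]
theorem HL_append {L M : List (ℤ × A)} : O.HL (L ++ M) ↔ O.HL L ∧ O.HL M := by
  simp [HL, or_imp, forall_and]
theorem HL_reverse {L : List (ℤ × A)} : O.HL L.reverse ↔ O.HL L := by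
  simp [HL]
theorem HL_take {L : List (ℤ × A)} (h : O.HL L) (i : ℕ) : O.HL (L.take i) :=
  fun e he => h e (List.mem_of_mem_take he)
theorem HL_drop {L : List (ℤ × A)} (h : O.HL L) (i : ℕ) : O.HL (L.drop i) :=
  fun e he => h e (List.mem_of_mem_drop he)

/-- `U` as a linear map in `x` -/
theorem U_lin (o r : ℕ) (L : List (ℤ × A)) : ∃ f : A →ₗ[K] A, ∀ x, O.U o r x L = f x := by
  induction r generalizing L with
  | zero =>
    cases L with
    | nil => exact ⟨LinearMap.id, fun x => rfl⟩
    | cons e L => exact ⟨0, fun x => rfl⟩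
  | succ r ih =>
    cases L with
    | nil => exact ⟨LinearMap.id, fun x => rfl⟩
    | cons e L =>
      obtain ⟨f, hf⟩ := ih (e :: L)
      obtain ⟨g, hg⟩ := ih L
      refine ⟨f + sgn K (((o : ℤ) + r + sd L) * (e.1 - 1)) • (g ∘ₗ (O.comp (o + r)).flip e.2), fun x => ?_⟩
      rw [U_succ, hf, hg]; simp

theorem U_add (o r : ℕ) (x x' : A) (L) : O.U o r (x + x') L = O.U o r x L + O.U o r x' L := by
  obtain ⟨f, hf⟩ := O.U_lin o r L; simp [hf]
theorem U_smul (o r : ℕ) (c : K) (x : A) (L) : O.U o r (c • x) L = c • O.U o r x L := by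
  obtain ⟨f, hf⟩ := O.U_lin o r L; simp [hf]
@[simp] theorem U_zero (o r : ℕ) (L) : O.U o r 0 L = 0 := by
  obtain ⟨f, hf⟩ := O.U_lin o r L; simp [hf]
theorem U_sub (o r : ℕ) (x x' : A) (L) : O.U o r (x - x') L = O.U o r x L - O.U o r x' L := by
  obtain ⟨f, hf⟩ := O.U_lin o r L; simp [hf]

/-- `U` is linear in each list entry -/
theorem U_lin_list (o r : ℕ) (L M : List (ℤ × A)) (q : ℤ) (x : A) :
    ∃ f : A →ₗ[K] A, ∀ y, O.U o r x (L ++ (q, y) :: M) = f y := by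
  induction r generalizing L x with
  | zero =>
    cases L with
    | nil => exact ⟨0, fun x => rfl⟩
    | cons e L => exact ⟨0, fun x => rfl⟩
  | succ r ih =>
    cases L with
    | nil =>
      obtain ⟨f, hf⟩ := ih [] x
      obtain ⟨g, hg⟩ := O.U_lin o r M
      refine ⟨f + sgn K (((o : ℤ) + r + sd M) * (q - 1)) • (g ∘ₗ (O.comp (o + r)) x), fun y => ?_⟩
      rw [List.nil_append, U_succ, hg, ← List.nil_append ((q, y) :: M), hf]; simp
    | cons e L =>
      obtain ⟨f, hf⟩ := ih (e :: L) x
      obtain ⟨g, hg⟩ := ih L (O.comp (o + r) x e.2)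
      refine ⟨f + sgn K (((o : ℤ) + r + (sd (L ++ (q, (0:A)) :: M))) * (e.1 - 1)) • g, fun y => ?_⟩
      rw [List.cons_append, U_succ, hg, ← List.cons_append, hf]; simp

theorem U_len {o r : ℕ} {x : A} {L : List (ℤ × A)} (h : r < L.length) : O.U o r x L = 0 := by
  induction r generalizing x L with
  | zero => cases L with
    | nil => simp at h
    | cons e L => rfl
  | succ r ih => cases L with
    | nil => simp at h
    | cons e L =>
      simp at h
      rw [U_succ, ih (by simp; omega), ih (by omega)]; simp

theorem U_gz {p : ℤ} {o r : ℕ} {x : A} {L : List (ℤ × A)} (hL : O.HL L) (hx : x ∈ O.gz p)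
    (h : (o : ℤ) + r ≤ p) : O.U o r x L ∈ O.gz (p + sd L) := by
  induction r generalizing x L p with
  | zero => cases L with
    | nil => simpa using hx
    | cons e L => simp
  | succ r ih => cases L with
    | nil => simpa using hx
    | cons e L =>
      rw [HL_cons] at hL
      rw [U_succ]
      refine Submodule.add_mem _ (ih ((O.HL_cons).2 hL) hx (by push_cast at h; omega)) (Submodule.smul_mem _ _ ?_)
      rcases O.gz_cases hL.1 with h0 | ⟨n, hn, h0⟩
      · simp [h0]
      have := ih (p := p + e.1 - 1) hL.2 (O.comp_gz (o + r) (by push_cast at *; omega) hx hL.1) (by push_cast at h; omega)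
      convert this using 2
      simp; ring

theorem U_nonneg {r : ℕ} {o : ℕ} {x : A} {L : List (ℤ × A)} (hL : O.HL L) (h : (r : ℤ) + sd L < 0) :
    O.U o r x L = 0 := by
  induction r generalizing x L with
  | zero => cases L with
    | nil => simp at h
    | cons e L => simp
  | succ r ih => cases L with
    | nil => simp at h; omega
    | cons e L =>
      rw [HL_cons] at hL
      simp at h
      rw [U_succ, ih ((O.HL_cons).2 hL) (by simp; omega)]
      rcases O.gz_cases hL.1 with h0 | ⟨n, hn, h0⟩
      · simp [h0]
      · rw [ih hL.2 (by omega)]; simp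

theorem lemA {p l : ℤ} {r t t' : ℕ} {x z : A} {L : List (ℤ × A)} (hL : O.HL L) (hx : x ∈ O.gz p)
    (hz : z ∈ O.gz l) (hrt : r ≤ t) (htp : (t : ℤ) < p) (ht' : (t' : ℤ) = t + sd L) :
    O.comp t' (O.U 0 r x L) z = O.U 0 r (O.comp t x z) L := by
  induction r generalizing x L p t t' with
  | zero => cases L with
    | nil => simp at ht'; simp [ht']
    | cons e L => simp
  | succ r ih => cases L with
    | nil => simp at ht'; simp [ht']
    | cons e L =>
      have hL' := hL
      rw [HL_cons] at hL
      simp at ht'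
      rw [U_succ, U_succ, map_add, map_smul, LinearMap.add_apply, LinearMap.smul_apply]
      rw [ih (t := t) hL' hx (by omega) htp (by simp [ht'])]
      congr 2
      rcases O.gz_cases hL.1 with h0 | ⟨n, hn, h0⟩
      · simp [h0]
      rw [ih (t := t + n - 1) (p := p + e.1 - 1) hL.2 (O.comp_gz _ (by push_cast; omega) hx hL.1) (by omega) (by omega) (by omega)]
      rw [zero_add, O.par_gz r t _ (by omega) htp _ hx hL.1 hz]
      omega

theorem lemA' {p : ℤ} {r o o' q : ℕ} {x : A} {L b : List (ℤ × A)} (hL : O.HL L) (hb : O.HL b)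
    (hx : x ∈ O.gz p) (hro : r ≤ o) (hop : (o : ℤ) + q ≤ p) (ho' : (o' : ℤ) = o + sd L) :
    O.U o' q (O.U 0 r x L) b = sgn K (sd L * sd b) • O.U 0 r (O.U o q x b) L := by
  induction q generalizing x b p with
  | zero => cases b with
    | nil => simp
    | cons e b => simp
  | succ q ih => cases b with
    | nil => simp
    | cons e b =>
      have hb' := hb
      rw [HL_cons] at hb
      push_cast at hop
      rw [U_succ, U_succ, ih hb' hx (by omega), U_add, smul_add, U_smul]
      congr 1
      rcases O.gz_cases hb.1 with h0 | ⟨n, hn, h0⟩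
      · simp [h0]
      rw [O.lemA (t := o + q) hL hx hb.1 (by omega) (by push_cast; omega) (by push_cast; omega)]
      rw [ih (p := p + e.1 - 1) hb.2 (O.comp_gz _ (by push_cast; omega) hx hb.1) (by omega)]
      rw [sgn_smul_smul, sgn_smul_smul]
      congr 1
      apply sgn_congr
      rw [ho', sd_cons]; push_cast; ring

theorem lemC {p l : ℤ} {o q : ℕ} {x y : A} {b : List (ℤ × A)} (hb : O.HL b)
    (hx : x ∈ O.gz p) (hy : y ∈ O.gz l) (ho : (o : ℤ) < p) (hq : (q : ℤ) ≤ l) :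
    O.U o q (O.comp o x y) b = sgn K (o * sd b) • O.comp o x (O.U 0 q y b) := by
  induction q generalizing y b l with
  | zero => cases b with
    | nil => simp
    | cons e b => simp
  | succ q ih => cases b with
    | nil => simp
    | cons e b =>
      have hb' := hb
      rw [HL_cons] at hb
      push_cast at hq
      rw [U_succ, U_succ, ih hb' hy (by omega), map_add, smul_add, map_smul]
      congr 1
      rcases O.gz_cases hb.1 with h0 | ⟨n, hn, h0⟩
      · simp [h0]
      rw [O.seq_gz o q ho (by omega) hx hy hb.1]
      rw [ih (l := l + e.1 - 1) hb.2 (O.comp_gz _ (by omega) hy hb.1) (by omega)]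
      rw [sgn_smul_smul, sgn_smul_smul, zero_add]
      congr 1
      apply sgn_congr
      rw [sd_cons]; push_cast; ring

theorem lemB (r q : ℕ) (X : A) (zs : List (ℤ × A)) :
    O.U 0 (r + q) X zs.reverse = ∑ i ∈ Finset.range (zs.length + 1),
      sgn K (sd (zs.drop i) * sd (zs.take i)) •
        O.U 0 r (O.U r q X (zs.drop i).reverse) (zs.take i).reverse := by
  induction q generalizing X zs with
  | zero =>
    rw [Finset.sum_range_succ, Finset.sum_eq_zero]
    · simp
    · intro i hi
      rw [O.U_len (o := r) (by simpa using hi)]; simp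
  | succ q ih =>
    rcases List.eq_nil_or_concat' zs with rfl | ⟨zs, z, rfl⟩
    · simp
    rw [List.length_append, List.length_singleton, Finset.sum_range_succ]
    have e1 : (zs ++ [z]).take (zs.length + 1) = zs ++ [z] := by rw [List.take_of_length_le]; simp
    have e2 : (zs ++ [z]).drop (zs.length + 1) = [] := by rw [List.drop_of_length_le]; simp
    have h1 : ∀ i ∈ Finset.range (zs.length + 1), (zs ++ [z]).take i = zs.take i := fun i hi => by
      rw [List.take_append_of_le_length]; simp at hi; omega
    have h2 : ∀ i ∈ Finset.range (zs.length + 1), (zs ++ [z]).drop i = zs.drop i ++ [z] := fun i hi => by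
      rw [List.drop_append_of_le_length]; simp at hi; omega
    rw [e1, e2]
    have ih1 := ih X (zs ++ [z])
    rw [List.length_append, List.length_singleton, Finset.sum_range_succ, e1, e2] at ih1
    rw [List.reverse_append, List.reverse_singleton, List.singleton_append] at ih1 ⊢
    rw [← add_assoc, U_succ, ih1, ih, add_right_comm]
    simp only [U_nil, List.reverse_nil]
    congr 1
    rw [Finset.smul_sum, ← Finset.sum_add_distrib]
    apply Finset.sum_congr rfl
    intro i hi
    rw [h1 i hi, h2 i hi, List.reverse_append, List.reverse_singleton, List.singleton_append, U_succ,
      U_add, smul_add, U_smul, sgn_smul_smul, sgn_smul_smul]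
    congr 2
    · apply sgn_congr
      have : sd zs = sd (zs.take i) + sd (zs.drop i) := by rw [← sd_append, List.take_append_drop]
      simp [this]; ring
    · simp

end NsOperad
namespace NsOperad
variable (O : NsOperad K A)

/-- brace with a forward list, with degree -/
def bl (y : ℤ × A) (b : List (ℤ × A)) : ℤ × A := (y.1 + sd b, O.U 0 y.1.toNat y.2 b.reverse)

@[simp] theorem bl_nil (y : ℤ × A) : O.bl y [] = y := by simp [bl]
@[simp] theorem bl_fst (y : ℤ × A) (b) : (O.bl y b).1 = y.1 + sd b := rfl

theorem bl_gz {y : ℤ × A} {b : List (ℤ × A)} (hy : y.2 ∈ O.gz y.1) (hb : O.HL b) :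
    (O.bl y b).2 ∈ O.gz (O.bl y b).1 := by
  rcases O.gz_cases hy with h | ⟨n, h, h'⟩
  · simp [bl, h]
  · have := O.U_gz (o := 0) (r := n) (p := n) (L := b.reverse) (O.HL_reverse.2 hb) h' (by simp)
    simp only [bl, h]
    simpa using this

/-- the right-hand side of the pre-Jacobi identity, on lists (`ys` reversed, `zs` forward) -/
def S : List (ℤ × A) → List (ℤ × A) → (List (ℤ × A) → A) → A
  | [], zs, F => F zs
  | y :: ys, zs, F => ∑ i ∈ Finset.range (zs.length + 1), ∑ r ∈ Finset.range (zs.length - i + 1),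
      sgn K ((y.1 - 1) * sd (zs.take i)) •
        S ys (zs.take i) (fun W => F (W ++ O.bl y ((zs.drop i).take r) :: zs.drop (i + r)))

theorem S_congr {ys zs : List (ℤ × A)} (hy : O.HL ys) (hz : O.HL zs) {F G : List (ℤ × A) → A}
    (h : ∀ W, O.HL W → sd W = sd ys + sd zs → F W = G W) : O.S ys zs F = O.S ys zs G := by
  induction ys generalizing zs F G with
  | nil => exact h _ hz (by simp)
  | cons y ys ih =>
    rw [HL_cons] at hy
    unfold S
    refine Finset.sum_congr rfl fun i _ => Finset.sum_congr rfl fun r _ => ?_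
    congr 1
    apply ih hy.2 (O.HL_take hz i)
    intro W hW hs
    apply h
    · rw [HL_append, HL_cons]
      exact ⟨hW, O.bl_gz hy.1 (O.HL_take (O.HL_drop hz i) r), O.HL_drop hz _⟩
    · have e1 : zs = zs.take i ++ ((zs.drop i).take r ++ zs.drop (i + r)) := by
        rw [← List.drop_drop, List.take_append_drop, List.take_append_drop]
      have e2 : sd zs = _ := congrArg sd e1
      rw [e2]
      simp only [hs, sd_append, sd_cons, bl_fst]; ring

theorem S_add (ys zs : List (ℤ × A)) (F G : List (ℤ × A) → A) :
    O.S ys zs (fun W => F W + G W) = O.S ys zs F + O.S ys zs G := by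
  induction ys generalizing zs F G with
  | nil => rfl
  | cons y ys ih =>
    unfold S
    simp only [ih, smul_add, Finset.sum_add_distrib]

theorem S_smul (ys zs : List (ℤ × A)) (c : K) (F : List (ℤ × A) → A) :
    O.S ys zs (fun W => c • F W) = c • O.S ys zs F := by
  induction ys generalizing zs F with
  | nil => rfl
  | cons y ys ih =>
    unfold S
    simp only [ih, Finset.smul_sum]
    refine Finset.sum_congr rfl fun i _ => Finset.sum_congr rfl fun r _ => ?_
    rw [smul_comm]

theorem S_nil (y : ℤ × A) (ys : List (ℤ × A)) (F : List (ℤ × A) → A) :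
    O.S (y :: ys) [] F = O.S ys [] (fun W => F (W ++ [y])) := by
  rw [S]; simp

theorem S_concat (y : ℤ × A) (ys zs : List (ℤ × A)) (z : ℤ × A) (F : List (ℤ × A) → A) :
    O.S (y :: ys) (zs ++ [z]) F = O.S (y :: ys) zs (fun W => F (W ++ [z])) +
      ∑ i ∈ Finset.range (zs.length + 1 + 1), sgn K ((y.1 - 1) * sd ((zs ++ [z]).take i)) •
        O.S ys ((zs ++ [z]).take i) (fun W => F (W ++ [O.bl y ((zs ++ [z]).drop i)])) := by
  rw [S, S, List.length_append, List.length_singleton, Finset.sum_range_succ, Finset.sum_range_succ _ (zs.length + 1),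
    ← add_assoc, ← Finset.sum_add_distrib]
  have e1 : (zs ++ [z]).take (zs.length + 1) = zs ++ [z] := by rw [List.take_of_length_le]; simp
  have e2 : (zs ++ [z]).drop (zs.length + 1) = [] := by rw [List.drop_of_length_le]; simp
  congr 1
  · refine Finset.sum_congr rfl fun i hi => ?_
    simp only [Finset.mem_range] at hi
    have h1 : (zs ++ [z]).take i = zs.take i := by
      rw [List.take_append_of_le_length]; omega
    have h2 : (zs ++ [z]).drop i = zs.drop i ++ [z] := by
      rw [List.drop_append_of_le_length]; omega
    have h3 : zs.length + 1 - i + 1 = (zs.length - i + 1) + 1 := by omega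
    rw [h3, Finset.sum_range_succ, h1, h2]
    congr 1
    · refine Finset.sum_congr rfl fun r hr => ?_
      simp only [Finset.mem_range] at hr
      have h4 : (zs.drop i ++ [z]).take r = (zs.drop i).take r := by
        rw [List.take_append_of_le_length]; simp; omega
      have h5 : (zs ++ [z]).drop (i + r) = zs.drop (i + r) ++ [z] := by
        rw [List.drop_append_of_le_length]; omega
      rw [h4, h5]
      simp
    · have h4 : (zs.drop i ++ [z]).take (zs.length - i + 1) = (zs.drop i) ++ [z] := by
        rw [List.take_of_length_le]; simp
      have h5 : (zs ++ [z]).drop (i + (zs.length - i + 1)) = [] := by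
        rw [List.drop_of_length_le]; simp; omega
      rw [h4, h5]
  · simp [e1, e2]

theorem core {p : ℤ} (r : ℕ) {x : A} {ys zs : List (ℤ × A)} (hx : x ∈ O.gz p) (hr : (r : ℤ) ≤ p)
    (hy : O.HL ys) (hz : O.HL zs) :
    O.U 0 ((r : ℤ) + sd ys).toNat (O.U 0 r x ys) zs.reverse =
      O.S ys zs (fun W => O.U 0 r x W.reverse) := by
  induction r generalizing p x ys zs with
  | zero =>
    cases ys with
    | nil => simp [S]
    | cons y ys =>
      rw [U_zero_cons, U_zero, S, Finset.sum_eq_zero]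
      intro i _
      rw [Finset.sum_eq_zero]
      intro r _
      have : ∀ W a (L : List (ℤ × A)), O.U 0 0 x (W ++ a :: L).reverse = (0 : K) • x := by
        intro W a L
        rw [O.U_len (by simp)]; simp
      simp only [this]
      rw [S_smul]; simp
  | succ r ih =>
    cases ys with
    | nil => simp [S]
    | cons y ys =>
      have hy' := hy
      rw [HL_cons] at hy
      push_cast at hr
      -- second part
      have P2 : ∀ zs, O.HL zs → O.U 0 (((r + 1 : ℕ) : ℤ) + sd (y :: ys)).toNat
          (sgn K (((0 : ℕ) + r + sd ys) * (y.1 - 1)) • O.U 0 r (O.comp (0 + r) x y.2) ys) zs.reverse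
          = ∑ i ∈ Finset.range (zs.length + 1), sgn K ((y.1 - 1) * sd (zs.take i)) •
            O.S ys (zs.take i) (fun W =>
              sgn K (((0 : ℕ) + r + sd W) * ((O.bl y (zs.drop i)).1 - 1)) •
              O.U 0 r (O.comp (0 + r) x (O.bl y (zs.drop i)).2) W.reverse) := by
        intro zs hz
        have key : ∀ i, O.S ys (zs.take i) (fun W =>
              sgn K (((0 : ℕ) + r + sd W) * ((O.bl y (zs.drop i)).1 - 1)) •
              O.U 0 r (O.comp (0 + r) x (O.bl y (zs.drop i)).2) W.reverse) =
              sgn K ((r + sd ys + sd (zs.take i)) * ((y.1 + sd (zs.drop i)) - 1)) •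
              O.U 0 ((r : ℤ) + sd ys).toNat (O.U 0 r (O.comp r x (O.bl y (zs.drop i)).2) ys)
                (zs.take i).reverse := by
          intro i
          have hz1 := O.HL_take hz i
          have hb := O.bl_gz hy.1 (O.HL_drop hz i)
          rw [O.S_congr hy.2 hz1 (G := fun W => sgn K ((r + sd ys + sd (zs.take i)) * ((y.1 + sd (zs.drop i)) - 1)) •
              O.U 0 r (O.comp r x (O.bl y (zs.drop i)).2) W.reverse)]
          · rw [S_smul]
            congr 1
            rcases O.gz_cases hb with h0 | ⟨n, hn, h0⟩
            · rw [h0, map_zero]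
              have := ih (p := p) (x := 0) (by simp) (by omega) hy.2 hz1
              rw [← this]
            · exact (ih (p := p + n - 1) (O.comp_gz r (by omega) hx (O.gz_of h0 rfl)) (by omega) hy.2 hz1).symm
          · intro W hW hs
            simp only [hs, bl_fst, zero_add]
            congr 2
            push_cast; ring
        simp only [key]
        by_cases h2 : (r : ℤ) + sd ys < 0
        · simp [O.U_nonneg hy.2 h2]
        rcases O.gz_cases hy.1 with h0 | ⟨n, hn, h0⟩
        · simp [h0, bl]
        obtain ⟨r2, hr2⟩ := Int.eq_ofNat_of_zero_le (not_lt.1 h2)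
        have e1 : (((r + 1 : ℕ) : ℤ) + sd (y :: ys)).toNat = r2 + n := by
          rw [sd_cons]; push_cast; omega
        have e2 : ((r : ℤ) + sd ys).toNat = r2 := by omega
        rw [e1, e2, U_smul, lemB, Finset.smul_sum]
        refine Finset.sum_congr rfl fun i _ => ?_
        rw [zero_add, O.lemA' (p := p + n - 1) (o := r) hy.2 (O.HL_reverse.2 (O.HL_drop hz i)) (O.comp_gz r (by omega) hx (O.gz_of h0 rfl)) le_rfl
            (by omega) (by omega),
          O.lemC (O.HL_reverse.2 (O.HL_drop hz i)) hx (O.gz_of h0 rfl) (by omega) le_rfl]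
        have e3 : (O.bl y (zs.drop i)).2 = O.U 0 n y.2 (zs.drop i).reverse := by
          simp [bl, hn]
        rw [e3]
        simp only [U_smul, sgn_smul_smul]
        congr 1
        apply sgn_congr
        simp only [sd_reverse]
        push_cast
        generalize ((r : ℤ) : ZMod 2) = a
        generalize ((sd ys : ℤ) : ZMod 2) = b
        generalize ((sd (zs.drop i) : ℤ) : ZMod 2) = c
        generalize ((sd (zs.take i) : ℤ) : ZMod 2) = d
        generalize ((y.1 : ℤ) : ZMod 2) = e
        generalize (r : ZMod 2) = a
        revert a b c d e
        decide
      rw [U_succ, U_add, P2 zs hz]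
      rcases List.eq_nil_or_concat' zs with rfl | ⟨zs, z, rfl⟩
      · have := ih (zs := []) hx (by omega) hy' O.HL_nil
        rw [S_nil] at this ⊢
        simp only [List.reverse_nil, U_nil, List.reverse_append, List.reverse_singleton, List.singleton_append] at this ⊢
        rw [this]
        simp only [U_succ, S_add]
        simp
      · have hz' := hz
        rw [HL_append, HL_cons] at hz
        have P1 : O.U 0 (((r + 1 : ℕ) : ℤ) + sd (y :: ys)).toNat (O.U 0 r x (y :: ys)) (zs ++ [z]).reverse
          = O.S (y :: ys) (zs ++ [z]) (fun W => O.U 0 r x W.reverse) +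
            O.S (y :: ys) zs (fun W => sgn K (((0 : ℕ) + r + sd W) * (z.1 - 1)) •
              O.U 0 r (O.comp (0 + r) x z.2) W.reverse) := by
          have key : O.S (y :: ys) zs (fun W => sgn K (((0 : ℕ) + r + sd W) * (z.1 - 1)) •
              O.U 0 r (O.comp (0 + r) x z.2) W.reverse) = 
              sgn K ((r + sd (y :: ys) + sd zs) * (z.1 - 1)) • 
              O.U 0 ((r : ℤ) + sd (y :: ys)).toNat (O.U 0 r (O.comp r x z.2) (y :: ys)) zs.reverse := by
            rw [O.S_congr hy' hz.1 (G := fun W => sgn K ((r + sd (y :: ys) + sd zs) * (z.1 - 1)) •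
              O.U 0 r (O.comp r x z.2) W.reverse)]
            · rw [S_smul]
              congr 1
              rcases O.gz_cases hz.2.1 with h0 | ⟨n, hn, h0⟩
              · rw [h0, map_zero]
                have := ih (p := p) (x := 0) (by simp) (by omega) hy' hz.1
                rw [← this]
              · exact (ih (p := p + n - 1) (O.comp_gz r (by omega) hx (O.gz_of h0 rfl)) (by omega) hy' hz.1).symm
            · intro W hW hs
              simp only [hs, zero_add]
              congr 2
              push_cast; ring
          rw [key, ← ih hx (by omega) hy' hz']
          by_cases h2 : (r : ℤ) + sd (y :: ys) < 0
          · simp [O.U_nonneg hy' h2]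
          obtain ⟨r1, hr1⟩ := Int.eq_ofNat_of_zero_le (not_lt.1 h2)
          have e1 : (((r + 1 : ℕ) : ℤ) + sd (y :: ys)).toNat = r1 + 1 := by push_cast; omega
          have e2 : ((r : ℤ) + sd (y :: ys)).toNat = r1 := by omega
          rw [e1, e2, List.reverse_append, List.reverse_singleton, List.singleton_append, U_succ]
          rw [O.lemA (t := r) hy' hx hz.2.1 le_rfl (by omega) (by omega)]
          congr 3
          rw [sd_reverse, hr1]; push_cast; simp
        rw [P1, S_concat, S_concat]
        simp only [List.reverse_append, List.reverse_singleton, List.singleton_append, U_succ, S_add, smul_add,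
          Finset.sum_add_distrib, sd_reverse, List.length_append, List.length_singleton]
        abel

theorem preJac {x : ℤ × A} {ys zs : List (ℤ × A)} (hx : x.2 ∈ O.gz x.1)
    (hy : O.HL ys) (hz : O.HL zs) :
    (O.bl (O.bl x ys) zs).2 = O.S ys.reverse zs (fun W => (O.bl x W).2) := by
  obtain ⟨p, x⟩ := x
  rcases O.gz_cases hx with h0 | ⟨n, hn, h0⟩
  · have := O.core (p := 0) 0 (x := 0) (by simp) (by simp) (O.HL_reverse.2 hy) hz
    simp only at h0
    subst h0
    simp [bl] at this ⊢
    exact this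
  · simp only at hn h0
    subst hn
    have := O.core (p := n) n (O.gz_of h0 rfl) (by simp) (O.HL_reverse.2 hy) hz
    simpa [bl] using this
end NsOperad
namespace NsOperad
variable (O : NsOperad K A)

/-- annotated list -/
def Lf {k : ℕ} (q : Fin k → ℤ) (y : Fin k → A) : List (ℤ × A) := List.ofFn (fun l => (q l, y l))

@[simp] theorem Lf_length {k : ℕ} (q : Fin k → ℤ) (y : Fin k → A) : (Lf q y).length = k := by simp [Lf]

theorem sd_Lf {k : ℕ} (q : Fin k → ℤ) (y : Fin k → A) : sd (Lf q y) = ∑ l, (q l - 1) := by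
  simp [sd, Lf, List.sum_ofFn]

theorem HL_Lf {k : ℕ} (q : Fin k → ℤ) (y : Fin k → A) (h : ∀ l, y l ∈ O.gz (q l)) : O.HL (Lf q y) := by
  intro e he
  simp [Lf, List.mem_ofFn] at he
  obtain ⟨i, rfl⟩ := he
  exact h i

theorem brace_eq (p : ℕ) {k : ℕ} (q : Fin k → ℕ) (x : A) (y : Fin k → A) :
    O.brace p q x y = O.U 0 p x (Lf (fun l => (q l : ℤ)) y).reverse := by
  induction p generalizing k x with
  | zero =>
    cases k with
    | zero => simp [brace, Lf, multiIns, Subsingleton.strictMono]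
    | succ k => 
      rw [O.U_len (by simp)]
      unfold brace
      apply Finset.sum_eq_zero
      intro j _
      exact (j 0).elim0
  | succ p ih =>
    cases k with
    | zero => simp [brace, Lf, multiIns, Subsingleton.strictMono]
    | succ k =>
      have e1 : (Lf (fun l => (q l : ℤ)) y).reverse = ((q (Fin.last k) : ℤ), y (Fin.last k)) ::
          (Lf (fun l : Fin k => (q l.castSucc : ℤ)) (fun l => y l.castSucc)).reverse := by
        unfold Lf
        rw [List.ofFn_succ', List.concat_eq_append]; simp
      rw [e1, U_succ, ← e1, ← ih, ← ih (fun l => q l.castSucc), sd_reverse, sd_Lf]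
      unfold brace
      rw [← Finset.sum_filter_not_add_sum_filter _ (fun j : Fin (k+1) → Fin (p+1) => j (Fin.last k) = Fin.last p)]
      congr 1
      · symm
        refine Finset.sum_bij (fun j _ l => (j l).castSucc) ?_ ?_ ?_ ?_
        · intro j hj
          simp only [Finset.mem_filter, Finset.mem_univ, true_and] at hj ⊢
          exact ⟨fun a b h => by simpa using hj h, (Fin.castSucc_lt_last _).ne⟩
        · intro j _ j' _ h
          funext l
          have := congrFun h l
          simpa using this
        · intro j hj
          simp only [Finset.mem_filter, Finset.mem_univ, true_and] at hj
          have h1 : ∀ l, (j l : ℕ) < p := fun l => by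
            have h2 := hj.1.monotone (Fin.le_last l)
            have h3 : (j (Fin.last k) : ℕ) ≠ p := fun h => hj.2 (Fin.ext h)
            have h4 := (j (Fin.last k)).isLt
            have h5 : (j l : ℕ) ≤ j (Fin.last k) := h2
            omega
          refine ⟨fun l => ⟨j l, h1 l⟩, ?_, ?_⟩
          · simp only [Finset.mem_filter, Finset.mem_univ, true_and]
            exact fun a b h => hj.1 h
          · funext l; simp
        · intro j hj
          simp
      · symm
        rw [Finset.smul_sum]
        refine Finset.sum_bij (fun j _ => Fin.snoc (α := fun _ => Fin (p+1)) (fun l => (j l).castSucc) (Fin.last p)) ?_ ?_ ?_ ?_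
        · intro j hj
          simp only [Finset.mem_filter, Finset.mem_univ, true_and] at hj ⊢
          refine ⟨fun a b h => ?_, by simp⟩
          induction a using Fin.lastCases with
          | last => exact absurd h (not_lt.2 (Fin.le_last b))
          | cast a =>
            induction b using Fin.lastCases with
            | last => simp
            | cast b => simpa using hj (by simpa using h)
        · intro j _ j' _ h
          funext l
          have := congrFun h l.castSucc
          simpa using this
        · intro j hj
          simp only [Finset.mem_filter, Finset.mem_univ, true_and] at hj
          have h1 : ∀ l : Fin k, (j l.castSucc : ℕ) < p := fun l => by
            have h2 : j l.castSucc < j (Fin.last k) := hj.1 (Fin.castSucc_lt_last l)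
            rw [hj.2] at h2
            exact h2
          refine ⟨fun l => ⟨j l.castSucc, h1 l⟩, ?_, ?_⟩
          · simp only [Finset.mem_filter, Finset.mem_univ, true_and]
            exact fun a b h => hj.1 (by simpa using h)
          · funext l
            induction l using Fin.lastCases with
            | last => simp [hj.2]
            | cast a => simp
        · intro j hj
          rw [sgn_smul_smul]
          congr 1
          · congr 1
            rw [Fin.sum_univ_castSucc, add_comm]
            congr 1
            · refine Finset.sum_congr rfl fun l _ => ?_
              simp only [Fin.snoc_castSucc, Fin.val_castSucc, Finset.sum_filter, Fin.sum_univ_castSucc,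
                Fin.castSucc_lt_castSucc_iff]
              rw [if_neg (not_lt.2 (Fin.le_last _))]
              simp
            · congr 1
              simp only [Fin.snoc_last, Fin.val_last, Finset.sum_filter, Fin.sum_univ_castSucc,
                lt_self_iff_false, Fin.castSucc_lt_last]
              simp; ring
          · rw [multiIns]; simp

theorem Lf_update {k : ℕ} (q : Fin k → ℤ) (y : Fin k → A) (i : Fin k) (q' : ℤ) (v : A) :
    Lf (Function.update q i q') (Function.update y i v) =
      (Lf q y).take i ++ (q', v) :: (Lf q y).drop (i + 1) := by
  have : Lf (Function.update q i q') (Function.update y i v) = (Lf q y).set i (q', v) := by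
    apply List.ext_getElem
    · simp
    intro n h1 h2
    simp only [Lf, List.getElem_set, List.getElem_ofFn, Function.update_apply, Fin.ext_iff]
    simp at h1
    by_cases h : (i : ℕ) = n
    · simp [h]
    · rw [if_neg h, if_neg (Ne.symm h), if_neg (Ne.symm h)]
  rw [this, List.set_eq_take_append_cons_drop]; simp

theorem Lf_update' {k : ℕ} (q : Fin k → ℤ) (y : Fin k → A) (i : Fin k) (v : A) :
    Lf q (Function.update y i v) =
      (Lf q y).take i ++ (q i, v) :: (Lf q y).drop (i + 1) := by
  rw [← Lf_update]; simp

theorem bl_lin_list (x : ℤ × A) (L M : List (ℤ × A)) (q : ℤ) :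
    ∃ f : A →ₗ[K] A, ∀ y, (O.bl x (L ++ (q, y) :: M)).2 = f y := by
  obtain ⟨f, hf⟩ := O.U_lin_list 0 x.1.toNat M.reverse L.reverse q x.2
  refine ⟨f, fun y => ?_⟩
  rw [← hf]
  simp [bl]

/-- fixed-degree multilinear braces -/
def brML (p : ℕ) {k : ℕ} (q : Fin k → ℕ) : A →ₗ[K] MultilinearMap K (fun _ : Fin k => A) A where
  toFun x := MultilinearMap.mk' (fun y => O.brace p q x y)
    (by
      intro y i v w
      simp only [brace_eq, Lf_update']
      obtain ⟨f, hf⟩ := O.bl_lin_list (p, x) ((Lf (fun l => (q l : ℤ)) y).take i) ((Lf (fun l => (q l : ℤ)) y).drop (i + 1)) (q i)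
      simp only [bl, Int.toNat_natCast] at hf
      simp only [hf, map_add])
    (by
      intro y i v w
      simp only [brace_eq, Lf_update']
      obtain ⟨f, hf⟩ := O.bl_lin_list (p, x) ((Lf (fun l => (q l : ℤ)) y).take i) ((Lf (fun l => (q l : ℤ)) y).drop (i + 1)) (q i)
      simp only [bl, Int.toNat_natCast] at hf
      simp only [hf, map_smul])
  map_add' x x' := by ext y; simp [brace_eq, U_add]
  map_smul' c x := by ext y; simp [brace_eq, U_smul]

theorem brML_apply (p : ℕ) {k : ℕ} (q : Fin k → ℕ) (x : A) (y : Fin k → A) :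
    O.brML p q x y = O.brace p q x y := rfl

/-- decomposition -/
def dec : A ≃ₗ[K] DirectSum ℕ (fun n => O.grading n) :=
  (LinearEquiv.ofBijective (DirectSum.coeLinearMap O.grading)
    (show Function.Bijective (DirectSum.coeLinearMap O.grading) from O.decomp)).symm

theorem dec_of {n : ℕ} {x : A} (h : x ∈ O.grading n) :
    O.dec x = DirectSum.lof K ℕ (fun n => O.grading n) n ⟨x, h⟩ := by
  rw [dec, LinearEquiv.symm_apply_eq, LinearEquiv.ofBijective_apply, DirectSum.coeLinearMap_lof]

/-- family of restricted braces -/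
def fam (p k : ℕ) (x : A) (q : Fin k → ℕ) : MultilinearMap K (fun i => O.grading (q i)) A :=
  (O.brML p q x).compLinearMap (fun i => (O.grading (q i)).subtype)

/-- braces with fixed degree of `x` -/
def mup (p k : ℕ) : A →ₗ[K] MultilinearMap K (fun _ : Fin k => A) A where
  toFun x := (MultilinearMap.fromDirectSumEquiv (R := K) (ι := Fin k) (κ := fun _ => ℕ)
      (M := fun _ n => O.grading n) (O.fam p k x)).compLinearMap
      (fun _ => O.dec.toLinearMap)
  map_add' x x' := by
    have : O.fam p k (x + x') = O.fam p k x + O.fam p k x' := by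
      funext q; ext; simp [fam]
    rw [this, map_add]; rfl
  map_smul' c x := by
    have : O.fam p k (c • x) = c • O.fam p k x := by
      funext q; ext; simp [fam]
    rw [this, map_smul]; rfl

theorem mup_apply (p k : ℕ) (x : A) (q : Fin k → ℕ) (y : Fin k → A) (h : ∀ l, y l ∈ O.grading (q l)) :
    O.mup p k x y = O.brace p q x y := by
  have : (fun i => O.dec (y i)) = fun i => DirectSum.lof K ℕ (fun n => O.grading n) (q i) ⟨y i, h i⟩ :=
    funext fun i => O.dec_of (h i)
  simp only [mup, LinearMap.coe_mk, AddHom.coe_mk, MultilinearMap.compLinearMap_apply, LinearEquiv.coe_coe, this]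
  rw [MultilinearMap.fromDirectSumEquiv_lof]
  simp [fam, brML_apply]

/-- the braces -/
def mu (k : ℕ) : A →ₗ[K] MultilinearMap K (fun _ : Fin k => A) A :=
  (DirectSum.toModule K ℕ _ (fun p => O.mup p k ∘ₗ (O.grading p).subtype)) ∘ₗ O.dec.toLinearMap

theorem mu_apply (p k : ℕ) (x : A) (q : Fin k → ℕ) (y : Fin k → A) (hx : x ∈ O.grading p)
    (h : ∀ l, y l ∈ O.grading (q l)) :
    O.mu k x y = O.brace p q x y := by
  simp only [mu, LinearMap.comp_apply, LinearEquiv.coe_coe, O.dec_of hx, DirectSum.toModule_lof]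
  exact O.mup_apply p k x q y h

theorem mu_bl {k : ℕ} {p : ℤ} {x : A} {q : Fin k → ℤ} {y : Fin k → A} (hx : x ∈ O.gz p)
    (h : ∀ l, y l ∈ O.gz (q l)) :
    O.mu k x y = (O.bl (p, x) (Lf q y)).2 := by
  rcases O.gz_cases hx with rfl | ⟨n, rfl, hx⟩
  · simp [bl]
  by_cases h0 : ∃ l, y l = 0
  · obtain ⟨l, hl⟩ := h0
    rw [MultilinearMap.map_coord_zero _ l hl]
    have e := Lf_update' q y l 0
    rw [← hl, Function.update_eq_self, hl] at e
    obtain ⟨f, hf⟩ := O.bl_lin_list ((n : ℤ), x) ((Lf q y).take l) ((Lf q y).drop (l + 1)) (q l)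
    rw [e, hf, map_zero]
  · push Not at h0
    have h1 : ∀ l, ∃ m : ℕ, q l = m ∧ y l ∈ O.grading m := fun l => by
      rcases O.gz_cases (h l) with h2 | h2
      · exact absurd h2 (h0 l)
      · exact h2
    choose q' hq hy using h1
    rw [O.mu_apply n k x q' y hx hy, brace_eq]
    have : q = fun l => (q' l : ℤ) := funext hq
    simp [bl, this]

end NsOperad
namespace InsLem

variable {n m : ℕ}

/-- extend insertion data by a last pair -/
def snoc {i r : ℕ} (h : i + r ≤ m) (t : InsData n i) : InsData (n + 1) m :=
  ⟨(Fin.snoc (α := fun _ => Fin (m + 1)) (fun a => ⟨(t.1.1 a : ℕ), by have := (t.1.1 a).isLt; omega⟩) ⟨i, by omega⟩,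
    Fin.snoc (α := fun _ => Fin (m + 1)) (fun a => ⟨(t.1.2 a : ℕ), by have := (t.1.2 a).isLt; omega⟩) ⟨r, by omega⟩), by
    constructor
    · intro a b hab
      induction a using Fin.lastCases with
      | last => exact absurd hab (not_lt.2 (Fin.le_last b))
      | cast a =>
        induction b using Fin.lastCases with
        | last => simpa using t.2.2 a
        | cast b => simpa using t.2.1 a b (by simpa using hab)
    · intro a
      induction a using Fin.lastCases with
      | last => simpa using h
      | cast a => 
        have := t.2.2 a
        simp
        omega⟩

@[simp] theorem snoc_i_last {i r : ℕ} (h : i + r ≤ m) (t : InsData n i) :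
    ((snoc h t).1.1 (Fin.last n) : ℕ) = i := by simp [snoc]
@[simp] theorem snoc_r_last {i r : ℕ} (h : i + r ≤ m) (t : InsData n i) :
    ((snoc h t).1.2 (Fin.last n) : ℕ) = r := by simp [snoc]
@[simp] theorem snoc_i_cast {i r : ℕ} (h : i + r ≤ m) (t : InsData n i) (a : Fin n) :
    ((snoc h t).1.1 a.castSucc : ℕ) = t.1.1 a := by simp [snoc]
@[simp] theorem snoc_r_cast {i r : ℕ} (h : i + r ≤ m) (t : InsData n i) (a : Fin n) :
    ((snoc h t).1.2 a.castSucc : ℕ) = t.1.2 a := by simp [snoc]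

theorem ext {s t : InsData n m} (h1 : ∀ a, (s.1.1 a : ℕ) = t.1.1 a)
    (h2 : ∀ a, (s.1.2 a : ℕ) = t.1.2 a) : s = t := by
  apply Subtype.ext
  apply Prod.ext
  · funext a; exact Fin.ext (h1 a)
  · funext a; exact Fin.ext (h2 a)

theorem exists_snoc (s : InsData (n + 1) m) : ∃ (i r : ℕ) (h : i + r ≤ m) (t : InsData n i), s = snoc h t := by
  have hb : ∀ a : Fin n, (s.1.1 a.castSucc : ℕ) + (s.1.2 a.castSucc : ℕ) ≤ s.1.1 (Fin.last n) := fun a =>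
    s.2.1 _ _ (Fin.castSucc_lt_last a)
  let t : InsData n (s.1.1 (Fin.last n) : ℕ) :=
    ⟨(fun a => ⟨s.1.1 a.castSucc, by have := hb a; omega⟩, fun a => ⟨s.1.2 a.castSucc, by have := hb a; omega⟩),
      fun a b hab => s.2.1 _ _ (by simpa using hab), fun a => hb a⟩
  refine ⟨s.1.1 (Fin.last n), s.1.2 (Fin.last n), s.2.2 _, t, ?_⟩
  apply ext
  · intro a
    induction a using Fin.lastCases with
    | last => exact (snoc_i_last _ _).symm
    | cast a => exact (snoc_i_cast _ t a).symm
  · intro a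
    induction a using Fin.lastCases with
    | last => exact (snoc_r_last _ _).symm
    | cast a => exact (snoc_r_cast _ t a).symm

/-- all the data as a sigma type -/
def E (n m : ℕ) (w : Σ i : Fin (m + 1), Σ _ : Fin (m - i + 1), InsData n i) : InsData (n + 1) m :=
  snoc (i := w.1) (r := w.2.1) (by have := w.1.isLt; have := w.2.1.isLt; omega) w.2.2

theorem E_bij (n m : ℕ) : Function.Bijective (E n m) := by
  constructor
  · rintro ⟨i, r, t⟩ ⟨i', r', t'⟩ h
    have h1 : (i : ℕ) = i' := by
      have := congrArg (fun s : InsData (n + 1) m => (s.1.1 (Fin.last n) : ℕ)) h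
      simpa [E] using this
    have h1 := Fin.ext h1
    subst h1
    have h1 : (r : ℕ) = r' := by
      have := congrArg (fun s : InsData (n + 1) m => (s.1.2 (Fin.last n) : ℕ)) h
      simpa [E] using this
    have h1 := Fin.ext h1
    subst h1
    have : t = t' := by
      apply ext
      · intro a
        have := congrArg (fun s : InsData (n + 1) m => (s.1.1 a.castSucc : ℕ)) h
        simpa [E] using this
      · intro a
        have := congrArg (fun s : InsData (n + 1) m => (s.1.2 a.castSucc : ℕ)) h
        simpa [E] using this
    rw [this]
  · intro s
    obtain ⟨i, r, h, t, rfl⟩ := exists_snoc s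
    exact ⟨⟨⟨i, by omega⟩, ⟨r, by simp; omega⟩, t⟩, rfl⟩

@[simp] theorem oPos_cast {i r : ℕ} (h : i + r ≤ m) (t : InsData n i) (a : Fin n) :
    oPos (snoc h t) a.castSucc = oPos t a := by
  unfold oPos
  rw [Finset.sum_filter, Fin.sum_univ_castSucc, Finset.sum_filter]
  simp [not_lt.2 (Fin.le_last _)]

@[simp] theorem oPos_last {i r : ℕ} (h : i + r ≤ m) (t : InsData n i) :
    oPos (snoc h t) (Fin.last n) = i + n - ∑ a : Fin n, (t.1.2 a : ℕ) := by
  unfold oPos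
  rw [Finset.sum_filter, Fin.sum_univ_castSucc]
  simp [Fin.castSucc_lt_last]

/-- index of the `z` at position `t` -/
def idx (s : InsData n m) (t : ℕ) : ℕ := t
        - (Finset.univ.filter (fun p : Fin n => oPos s p < t)).card
        + ∑ p ∈ Finset.univ.filter (fun p : Fin n => oPos s p < t), (s.1.2 p : ℕ)

theorem facts (s : InsData n m) : (∑ a, (s.1.2 a : ℕ) ≤ m) ∧ (∀ p, oPos s p < n + m - ∑ a, (s.1.2 a : ℕ)) ∧
    Function.Injective (oPos s) := by
  induction n generalizing m with
  | zero => exact ⟨by simp, fun p => p.elim0, fun p => p.elim0⟩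
  | succ n ih =>
    obtain ⟨i, r, h, t, rfl⟩ := exists_snoc s
    obtain ⟨h1, h2, h3⟩ := ih t
    rw [Fin.sum_univ_castSucc]
    simp only [snoc_r_cast, snoc_r_last]
    refine ⟨by omega, ?_, ?_⟩
    · intro p
      induction p using Fin.lastCases with
      | last => simp; omega
      | cast p => 
        have := h2 p
        simp; omega
    · intro p q hpq
      induction p using Fin.lastCases with
      | last => 
        induction q using Fin.lastCases with
        | last => rfl
        | cast q => 
          have := h2 q
          simp at hpq; omega
      | cast p => 
        induction q using Fin.lastCases with
        | last => 
          have := h2 p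
          simp at hpq; omega
        | cast q => 
          simp at hpq
          rw [h3 hpq]

theorem idx_snoc_lt {i r : ℕ} (h : i + r ≤ m) (t : InsData n i) (k : ℕ)
    (hk : k ≤ i + n - ∑ a : Fin n, (t.1.2 a : ℕ)) : idx (snoc h t) k = idx t k := by
  unfold idx
  rw [Finset.card_filter, Finset.card_filter, Finset.sum_filter, Finset.sum_filter, Fin.sum_univ_castSucc, Fin.sum_univ_castSucc]
  simp [not_lt.2 hk]

theorem idx_snoc_gt {i r : ℕ} (h : i + r ≤ m) (t : InsData n i) (k : ℕ) :
    idx (snoc h t) ((n + i - ∑ a : Fin n, (t.1.2 a : ℕ)) + 1 + k) = i + r + k := by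
  obtain ⟨h1, h2, h3⟩ := facts t
  unfold idx
  rw [Finset.card_filter, Finset.sum_filter, Fin.sum_univ_castSucc, Fin.sum_univ_castSucc]
  have h4 : ∀ p, oPos t p < (n + i - ∑ a : Fin n, (t.1.2 a : ℕ)) + 1 + k := fun p => by
    have := h2 p; omega
  have h5 : i + n - ∑ a : Fin n, (t.1.2 a : ℕ) < (n + i - ∑ a : Fin n, (t.1.2 a : ℕ)) + 1 + k := by omega
  simp [h4, h5]
  omega

theorem idx_lt (s : InsData n m) (k : ℕ) (hk : k < n + m - ∑ a, (s.1.2 a : ℕ)) (h : ∀ p, oPos s p ≠ k) :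
    idx s k < m := by
  induction n generalizing m with
  | zero => simp [idx]; simpa using hk
  | succ n ih =>
    obtain ⟨i, r, h', t, rfl⟩ := exists_snoc s
    obtain ⟨h1, h2, h3⟩ := facts t
    rw [Fin.sum_univ_castSucc] at hk
    simp only [snoc_r_cast, snoc_r_last] at hk
    have h4 := h (Fin.last n)
    simp only [oPos_last] at h4
    rcases lt_or_gt_of_ne h4 with h5 | h5
    · obtain ⟨j, rfl⟩ : ∃ j, k = (n + i - ∑ a : Fin n, (t.1.2 a : ℕ)) + 1 + j := ⟨k - ((n + i - ∑ a : Fin n, (t.1.2 a : ℕ)) + 1), by omega⟩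
      rw [idx_snoc_gt]; omega
    · rw [idx_snoc_lt _ _ _ h5.le]
      have := ih t (by omega) (fun p => by simpa using h p.castSucc)
      omega

variable {W : Type u} [AddCommGroup W] (μf : ∀ k : ℕ, W → (Fin k → W) → W)

theorem args_o (s : InsData n m) (y : Fin n → W) (z : Fin m → W) (t : Fin (n + m - ∑ a : Fin n, (s.1.2 a : ℕ))) (p : Fin n) (h : oPos s p = (t : ℕ)) :
    insArgs μf s y z t = μf (s.1.2 p : ℕ) (y p) (fun k : Fin (s.1.2 p : ℕ) => z ⟨(s.1.1 p : ℕ) + (k : ℕ), by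
          have h1 := s.2.2 p
          have h2 := k.isLt
          omega⟩) := by
  have hx : ∃ p : Fin n, oPos s p = (t : ℕ) := ⟨p, h⟩
  unfold insArgs
  rw [dif_pos hx]
  have : hx.choose = p := (facts s).2.2 (hx.choose_spec.trans h.symm)
  have key : ∀ p' : Fin n, p' = p → μf (s.1.2 p' : ℕ) (y p') (fun k : Fin (s.1.2 p' : ℕ) => z ⟨(s.1.1 p' : ℕ) + (k : ℕ), by
          have h1 := s.2.2 p'
          have h2 := k.isLt
          omega⟩) = μf (s.1.2 p : ℕ) (y p) (fun k : Fin (s.1.2 p : ℕ) => z ⟨(s.1.1 p : ℕ) + (k : ℕ), by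
          have h1 := s.2.2 p
          have h2 := k.isLt
          omega⟩) := by
    rintro _ rfl
    rfl
  exact key _ this

theorem args_z (s : InsData n m) (y : Fin n → W) (z : Fin m → W) (t : Fin (n + m - ∑ a : Fin n, (s.1.2 a : ℕ))) (h : ∀ p, oPos s p ≠ (t : ℕ)) :
    insArgs μf s y z t = z ⟨idx s t, idx_lt s t t.isLt h⟩ := by
  unfold insArgs
  rw [dif_neg (by push Not; exact h)]
  have := idx_lt s t t.isLt h
  unfold idx at *
  simp only [this, dif_pos]

/-- list version -/
theorem args_list {i r : ℕ} (h : i + r ≤ m) (t : InsData n i) (y : Fin (n + 1) → W) (z : Fin m → W)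
    (g : W → List W → W) :
    List.ofFn (insArgs (fun _ a b => g a (List.ofFn b)) (snoc h t) y z) =
      List.ofFn (insArgs (fun _ a b => g a (List.ofFn b)) t (fun a => y a.castSucc) (fun b => z ⟨b, by have := b.isLt; omega⟩)) ++
        g (y (Fin.last n)) (((List.ofFn z).drop i).take r) :: (List.ofFn z).drop (i + r) := by
  obtain ⟨h1, h2, h3⟩ := facts t
  have hs : ∑ a, ((snoc h t).1.2 a : ℕ) = ∑ a, (t.1.2 a : ℕ) + r := by
    rw [Fin.sum_univ_castSucc]; simp
  apply List.ext_getElem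
  · simp only [List.length_ofFn, List.length_append, List.length_cons, List.length_drop]
    omega
  · intro k hk1 hk2
    simp only [List.length_ofFn] at hk1
    rw [List.getElem_ofFn]
    rcases lt_trichotomy k (n + i - ∑ a, (t.1.2 a : ℕ)) with hk | hk | hk
    · rw [List.getElem_append_left (by simpa using hk), List.getElem_ofFn]
      by_cases hp : ∃ p, oPos t p = k
      · obtain ⟨p, hp⟩ := hp
        rw [args_o _ _ _ _ _ p hp, args_o _ _ _ _ _ p.castSucc (by simpa using hp)]
        congr 1
        apply List.ext_getElem
        · simp
        · intro j h1 h2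
          simp
      · push Not at hp
        rw [args_z, args_z _ _ _ _ _ hp]
        · congr 2
          apply idx_snoc_lt
          simp only; omega
        · intro p
          induction p using Fin.lastCases with
          | last => simp only [oPos_last]; omega
          | cast p => simpa using hp p
    · rw [List.getElem_append_right (by simp; omega)]
      rw [args_o _ _ _ _ _ (Fin.last n) (by simp only [oPos_last]; omega)]
      simp only [hk, List.length_ofFn, Nat.sub_self, List.getElem_cons_zero]
      congr 1
      apply List.ext_getElem
      · simp; omega
      · intro j h1 h2
        simp
    · obtain ⟨j, rfl⟩ : ∃ j, k = (n + i - ∑ a : Fin n, (t.1.2 a : ℕ)) + 1 + j := ⟨k - ((n + i - ∑ a : Fin n, (t.1.2 a : ℕ)) + 1), by omega⟩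
      rw [List.getElem_append_right (by simp; omega), args_z]
      · simp only [idx_snoc_gt, List.length_ofFn]
        have : n + i - ∑ a, (t.1.2 a : ℕ) + 1 + j - (n + i - ∑ a, (t.1.2 a : ℕ)) = j + 1 := by omega
        simp only [this, List.getElem_cons_succ, List.getElem_drop, List.getElem_ofFn]
      · intro p
        induction p using Fin.lastCases with
        | last => simp only [oPos_last]; omega
        | cast p => have := h2 p; simp only [oPos_cast]; omega

end InsLem

namespace NsOperad
variable (O : NsOperad K A)

theorem S_ins (n m : ℕ) (Y : Fin n → ℤ × A) (Z : Fin m → ℤ × A) (F : List (ℤ × A) → A) :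
    O.S (List.ofFn Y).reverse (List.ofFn Z) F = ∑ s : InsData n m,
      sgn K (insExp s (fun a => (Y a).1) (fun b => (Z b).1)) •
        F (List.ofFn (insArgs (W := ℤ × A) (fun _ a b => O.bl a (List.ofFn b)) s Y Z)) := by
  induction n generalizing m F with
  | zero =>
    have : Unique (InsData 0 m) := 
      { default := ⟨(fun a => a.elim0, fun a => a.elim0), fun a => a.elim0, fun a => a.elim0⟩
        uniq := fun s => InsLem.ext (fun a => a.elim0) (fun a => a.elim0) }
    rw [Fintype.sum_unique]
    simp only [List.ofFn_zero, List.reverse_nil, S, insExp, Finset.univ_eq_empty, Finset.sum_empty, sgn_zero, one_smul]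
    congr 1
    apply List.ext_getElem
    · simp
    · intro k h1 h2
      rw [List.getElem_ofFn, List.getElem_ofFn, InsLem.args_z]
      · simp [InsLem.idx]
      · intro p; exact p.elim0
  | succ n ih =>
    rw [List.ofFn_succ', List.concat_eq_append, List.reverse_append, List.reverse_singleton, List.singleton_append, S,
      ← (InsLem.E_bij n m).sum_comp, Fintype.sum_sigma, Finset.sum_range, List.length_ofFn]
    refine Finset.sum_congr rfl fun i _ => ?_
    rw [Fintype.sum_sigma, Finset.sum_range]
    refine Finset.sum_congr rfl fun r _ => ?_
    have hi := i.isLt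
    have hr := r.isLt
    have e1 : (List.ofFn Z).take i = List.ofFn (fun b : Fin i => Z ⟨b, by have := b.isLt; omega⟩) := by
      apply List.ext_getElem
      · simp; omega
      · intro k h1 h2; simp
    rw [e1, ih, Finset.smul_sum]
    refine Finset.sum_congr rfl fun t _ => ?_
    rw [sgn_smul_smul]
    simp only [InsLem.E]
    rw [InsLem.args_list]
    congr 1
    apply sgn_congr
    simp only [insExp]
    rw [Fin.sum_univ_castSucc]
    have e2 : ∀ k : ℕ, k ≤ i → ∑ q ∈ Finset.univ.filter (fun q : Fin m => (q : ℕ) < k), ((Z q).1 + 1) =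
        ∑ q ∈ Finset.univ.filter (fun q : Fin i => (q : ℕ) < k), ((Z ⟨q, by have := q.isLt; omega⟩).1 + 1) := by
      intro k hk
      symm
      refine Finset.sum_bij (fun q _ => ⟨q, by have := q.isLt; omega⟩) ?_ ?_ ?_ ?_
      · intro q hq; simpa using hq
      · intro q _ q' _ h; simpa [Fin.ext_iff] using h
      · intro q hq
        simp only [Finset.mem_filter, Finset.mem_univ, true_and] at hq
        exact ⟨⟨q, by omega⟩, by simpa using hq, rfl⟩
      · intro q _; rfl
    simp only [InsLem.snoc_i_cast, InsLem.snoc_i_last]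
    rw [e2 i le_rfl]
    have e3 : ∀ a : Fin n, ∑ q ∈ Finset.univ.filter (fun q : Fin m => (q : ℕ) < t.1.1 a), ((Z q).1 + 1) = _ := fun a => e2 (t.1.1 a) (by have := (t.1.1 a).isLt; omega)
    simp only [e3]
    have e4 : sd (List.ofFn (fun b : Fin i => Z ⟨b, by have := b.isLt; omega⟩)) = ∑ q : Fin i, ((Z ⟨q, by have := q.isLt; omega⟩).1 - 1) := by
      simp [sd, List.sum_ofFn]
    rw [e4]
    have e5 : Finset.univ.filter (fun q : Fin i => (q : ℕ) < i) = Finset.univ := by simp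
    rw [e5]
    push_cast
    have h2 : ∀ a : ZMod 2, a - 1 = a + 1 := by decide
    simp only [h2]
    ring

theorem snd_args (n m : ℕ) (s : InsData n m) (e : Fin n → ℤ) (f : Fin m → ℤ) (y : Fin n → A) (z : Fin m → A)
    (hy : ∀ a, y a ∈ O.gz (e a)) (hz : ∀ a, z a ∈ O.gz (f a)) (t : Fin (n + m - ∑ a : Fin n, (s.1.2 a : ℕ))) :
    (insArgs (W := ℤ × A) (fun _ a b => O.bl a (List.ofFn b)) s (fun a => (e a, y a)) (fun b => (f b, z b)) t).2 = 
      insArgs (fun k a b => O.mu k a b) s y z t ∧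
    (insArgs (W := ℤ × A) (fun _ a b => O.bl a (List.ofFn b)) s (fun a => (e a, y a)) (fun b => (f b, z b)) t).2 ∈ 
      O.gz (insArgs (W := ℤ × A) (fun _ a b => O.bl a (List.ofFn b)) s (fun a => (e a, y a)) (fun b => (f b, z b)) t).1 := by
  by_cases hp : ∃ p, oPos s p = t
  · obtain ⟨p, hp⟩ := hp
    rw [InsLem.args_o _ _ _ _ _ p hp, InsLem.args_o _ _ _ _ _ p hp]
    constructor
    · symm
      exact O.mu_bl (hy p) (fun l => hz _)
    · exact O.bl_gz (hy p) (O.HL_Lf (fun _ => f _) (fun _ => z _) fun l => hz _)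
  · push Not at hp
    rw [InsLem.args_z _ _ _ _ _ hp, InsLem.args_z _ _ _ _ _ hp]
    exact ⟨rfl, hz _⟩

theorem isPreJacobi : IsPreJacobi (fun k x y => O.mu k x y) O.gz := by
  intro n m d e f x y z hx hy hz
  show O.mu m (O.mu n x y) z = _
  have h1 := O.bl_gz (y := (d, x)) hx (O.HL_Lf e y hy)
  have h2 := O.preJac (x := (d, x)) hx (O.HL_Lf e y hy) (O.HL_Lf f z hz)
  rw [O.mu_bl hx hy, O.mu_bl h1 hz]
  refine h2.trans ?_
  unfold Lf
  rw [S_ins]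
  refine Finset.sum_congr rfl fun s _ => ?_
  congr 1
  have h3 := O.snd_args n m s e f y z hy hz
  have h4 := fun t => (h3 t).1
  have h5 := fun t => (h3 t).2
  have h6 := O.mu_bl (p := d) hx h5
  refine Eq.trans ?_ ((h6.symm).trans ?_)
  · rfl
  · exact congrArg (O.mu _ x) (funext h4)

end NsOperad
namespace NsOperad
variable (O : NsOperad K A)

theorem gz_internal : DirectSum.IsInternal O.gz := by
  have h := DirectSum.isInternal_submodule_iff_iSupIndep_and_iSup_eq_top O.grading |>.1 O.decomp
  rw [DirectSum.isInternal_submodule_iff_iSupIndep_and_iSup_eq_top]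
  constructor
  · rw [← iSupIndep_ne_bot]
    have hz : ∀ i : {i // O.gz i ≠ ⊥}, 0 ≤ i.1 := fun i => by
      by_contra hi
      exact i.2 (O.gz_neg (not_le.1 hi))
    have := h.1.comp (f := fun i : {i // O.gz i ≠ ⊥} => i.1.toNat) (by
      intro i j hij
      have h1 := hz i
      have h2 := hz j
      simp only at hij
      exact Subtype.ext (by omega))
    convert this using 2 with i
    rw [Function.comp, ← gz_natCast, Int.toNat_of_nonneg (hz i)]
  · rw [eq_top_iff, ← h.2]
    exact iSup_le fun n => (O.gz_natCast n ▸ le_iSup O.gz (n : ℤ))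

theorem hom_ind {P : A → Prop} (h0 : ∀ (a : ℤ) (x : A), x ∈ O.gz a → P x)
    (ha : ∀ x y, P x → P y → P (x + y)) (x : A) : P x := by
  have h := (DirectSum.isInternal_submodule_iff_iSupIndep_and_iSup_eq_top O.gz |>.1 O.gz_internal).2
  have hx : x ∈ ⨆ i, O.gz i := h ▸ Submodule.mem_top
  exact Submodule.iSup_induction O.gz (motive := P) hx h0 (h0 0 0 (Submodule.zero_mem _)) ha

/-- sign involution -/
def sig : A →ₗ[K] A :=
  (DirectSum.toModule K ℕ _ (fun p => sgn K (p : ℤ) • (O.grading p).subtype)) ∘ₗ O.dec.toLinearMap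

theorem sig_gz {a : ℤ} {x : A} (h : x ∈ O.gz a) : O.sig x = sgn K a • x := by
  rcases O.gz_cases h with rfl | ⟨n, rfl, hx⟩
  · simp
  · simp [sig, O.dec_of hx, DirectSum.toModule_lof]

/-- one argument brace, bilinear -/
def b1 : A →ₗ[K] A →ₗ[K] A := LinearMap.mk₂ K (fun x y => O.mu 1 x ![y])
  (by intros; simp) (by intros; simp)
  (by intro x y y'
      exact MultilinearMap.cons_add (M := fun _ : Fin 1 => A) (O.mu 1 x) ![] y y')
  (by intro c x y
      exact MultilinearMap.cons_smul (M := fun _ : Fin 1 => A) (O.mu 1 x) ![] c y)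

theorem b1_apply (x y : A) : O.b1 x y = O.mu 1 x ![y] := rfl

/-- two argument brace with fixed `m`, bilinear -/
def b2 (m : A) : A →ₗ[K] A →ₗ[K] A := LinearMap.mk₂ K (fun x y => O.mu 2 m ![x, y])
  (by intro y y' z
      exact MultilinearMap.cons_add (M := fun _ : Fin 2 => A) (O.mu 2 m) ![z] y y')
  (by intro c y z
      exact MultilinearMap.cons_smul (M := fun _ : Fin 2 => A) (O.mu 2 m) ![z] c y)
  (by intro x y y'
      have h : ∀ y : A, ![x, y] = Function.update ![x, 0] 1 y := by
        intro y; ext i; fin_cases i <;> simp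
      rw [h (y + y'), h y, h y', MultilinearMap.map_update_add])
  (by intro c x y
      have h : ∀ y : A, ![x, y] = Function.update ![x, 0] 1 y := by
        intro y; ext i; fin_cases i <;> simp
      rw [h (c • y), h y, MultilinearMap.map_update_smul])

theorem b2_apply (m x y : A) : O.b2 m x y = O.mu 2 m ![x, y] := rfl

/-- the differential -/
def dd (m : A) : A →ₗ[K] A := O.b1 m + (O.b1.flip m) ∘ₗ O.sig
/-- the cup product -/
def cup (m : A) : A →ₗ[K] A →ₗ[K] A := O.b2 m ∘ₗ O.sig

/-- the differential on pairs -/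
def D (M X : ℤ × A) : ℤ × A := (X.1 + 1, (O.bl M [X]).2 + sgn K X.1 • (O.bl X [M]).2)
/-- the cup product on pairs -/
def C (M X Y : ℤ × A) : ℤ × A := (X.1 + Y.1, sgn K X.1 • (O.bl M [X, Y]).2)

variable {m : A} (hm : m ∈ O.gz 2)
include hm

theorem dd_eq {a : ℤ} {x : A} (h : x ∈ O.gz a) : O.dd m x = (O.D (2, m) (a, x)).2 := by
  have e1 := O.mu_bl (k := 1) (q := ![a]) (y := ![x]) hm (by simpa using h)
  have e2 := O.mu_bl (k := 1) (q := ![2]) (y := ![m]) h (by simpa using hm)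
  simp only [dd, D, LinearMap.add_apply, LinearMap.comp_apply, LinearMap.flip_apply, O.sig_gz h, map_smul, LinearMap.smul_apply]
  rw [b1_apply, b1_apply, e1, e2]
  simp [Lf]

theorem cup_eq {a b : ℤ} {x y : A} (h : x ∈ O.gz a) (h' : y ∈ O.gz b) :
    O.cup m x y = (O.C (2, m) (a, x) (b, y)).2 := by
  have e1 := O.mu_bl (k := 2) (q := ![a, b]) (y := ![x, y]) hm (by
    intro l; fin_cases l
    · exact h
    · exact h')
  simp only [cup, C, LinearMap.comp_apply, O.sig_gz h, map_smul, LinearMap.smul_apply]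
  rw [b2_apply, e1]
  simp [Lf]

theorem D_gz {X : ℤ × A} (h : X.2 ∈ O.gz X.1) : (O.D (2, m) X).2 ∈ O.gz (O.D (2, m) X).1 := by
  have h1 := O.bl_gz (y := (2, m)) (b := [X]) hm (by simpa [HL] using h)
  have h2 := O.bl_gz (y := X) (b := [(2, m)]) h (by simpa [HL] using hm)
  simp only [D]
  apply Submodule.add_mem
  · convert h1 using 2; simp; ring
  · apply Submodule.smul_mem
    convert h2 using 2; simp

theorem C_gz {X Y : ℤ × A} (h : X.2 ∈ O.gz X.1) (h' : Y.2 ∈ O.gz Y.1) :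
    (O.C (2, m) X Y).2 ∈ O.gz (O.C (2, m) X Y).1 := by
  have h1 := O.bl_gz (y := (2, m)) (b := [X, Y]) hm (by simp [HL, h, h'])
  simp only [C]
  apply Submodule.smul_mem
  convert h1 using 2; simp; ring

end NsOperad
namespace NsOperad
variable (O : NsOperad K A)

theorem bl_list_add (x : ℤ × A) (L N : List (ℤ × A)) (q : ℤ) (u v : A) :
    (O.bl x (L ++ (q, u + v) :: N)).2 = (O.bl x (L ++ (q, u) :: N)).2 + (O.bl x (L ++ (q, v) :: N)).2 := by
  obtain ⟨f, hf⟩ := O.bl_lin_list x L N q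
  simp [hf]

theorem bl_list_smul (x : ℤ × A) (L N : List (ℤ × A)) (q : ℤ) (c : K) (u : A) :
    (O.bl x (L ++ (q, c • u) :: N)).2 = c • (O.bl x (L ++ (q, u) :: N)).2 := by
  obtain ⟨f, hf⟩ := O.bl_lin_list x L N q
  simp [hf]

theorem bl_list_zero (x : ℤ × A) (L N : List (ℤ × A)) (Y : ℤ × A) (h : Y.2 = 0) :
    (O.bl x (L ++ Y :: N)).2 = 0 := by
  obtain ⟨q, y⟩ := Y
  simp only at h
  subst h
  obtain ⟨f, hf⟩ := O.bl_lin_list x L N q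
  simp [hf]

theorem bl_add (q : ℤ) (u v : A) (L : List (ℤ × A)) :
    (O.bl (q, u + v) L).2 = (O.bl (q, u) L).2 + (O.bl (q, v) L).2 := by
  simp [bl, U_add]
theorem bl_smul (q : ℤ) (c : K) (u : A) (L : List (ℤ × A)) :
    (O.bl (q, c • u) L).2 = c • (O.bl (q, u) L).2 := by
  simp [bl, U_smul]
theorem bl_zero (Y : ℤ × A) (h : Y.2 = 0) (L : List (ℤ × A)) : (O.bl Y L).2 = 0 := by
  simp [bl, h]

theorem m_van (m : A) {L : List (ℤ × A)} (h : 3 ≤ L.length) : (O.bl (2, m) L).2 = 0 := by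
  simp only [bl]
  rw [O.U_len]
  simp; omega

theorem one_pj {x y : ℤ × A} {L : List (ℤ × A)} (hx : x.2 ∈ O.gz x.1) (hy : y.2 ∈ O.gz y.1) (hL : O.HL L) :
    (O.bl (O.bl x [y]) L).2 = ∑ i ∈ Finset.range (L.length + 1), ∑ r ∈ Finset.range (L.length - i + 1),
      sgn K ((y.1 - 1) * sd (L.take i)) •
        (O.bl x (L.take i ++ O.bl y ((L.drop i).take r) :: L.drop (i + r))).2 := by
  rw [O.preJac hx (by simpa [HL] using hy) hL]
  simp [S]

variable {m : A} (hm : m ∈ O.gz 2)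
include hm

theorem mx_pj {x : ℤ × A} {L : List (ℤ × A)} {n : ℕ} (hn : L.length = n + 1)
    (hx : x.2 ∈ O.gz x.1) (hL : O.HL L) :
    (O.bl (O.bl (2, m) [x]) L).2 = (O.bl (2, m) [O.bl x L]).2 +
      sgn K ((x.1 - 1) * sd (L.take 1)) • (O.bl (2, m) (L.take 1 ++ [O.bl x (L.drop 1)])).2 +
      (O.bl (2, m) (O.bl x (L.take n) :: L.drop n)).2 := by
  rw [O.one_pj hm hx hL, hn, Finset.sum_range_succ', Finset.sum_range_succ', Finset.sum_eq_zero (s := Finset.range n)]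
  · rw [Finset.sum_range_succ, Finset.sum_eq_zero]
    · have h0 : n + 1 - 0 + 1 = n + 1 + 1 := by omega
      rw [h0, Finset.sum_range_succ, Finset.sum_range_succ, Finset.sum_eq_zero]
      · have h1 : n + 1 - (0 + 1) = n := by omega
        have h2 : (L.drop 1).take n = L.drop 1 := by rw [List.take_of_length_le]; simp; omega
        have h3 : L.drop (n + 1) = [] := by rw [List.drop_of_length_le]; omega
        have h4 : L.take (n + 1) = L := by rw [List.take_of_length_le]; omega
        have h5 : 0 + 1 + n = n + 1 := by omega
        have h6 : L.tail.take n = L.tail := by simpa using h2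
        simp [h6, h3, h4, h5]
        abel
      · intro r hr
        rw [O.m_van, smul_zero]
        simp at hr
        simp; omega
    · intro r hr
      rw [O.m_van, smul_zero]
      simp at hr
      simp; omega
  · intro i hi
    apply Finset.sum_eq_zero
    intro r hr
    rw [O.m_van, smul_zero]
    simp at hi
    simp; omega

theorem mxy_pj {x y : ℤ × A} {L : List (ℤ × A)}
    (hx : x.2 ∈ O.gz x.1) (hy : y.2 ∈ O.gz y.1) (hL : O.HL L) :
    (O.bl (O.bl (2, m) [x, y]) L).2 = ∑ i ∈ Finset.range (L.length + 1),
      sgn K ((y.1 - 1) * sd (L.take i)) • (O.bl (2, m) [O.bl x (L.take i), O.bl y (L.drop i)]).2 := by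
  rw [O.preJac hm (by simp [HL, hx, hy]) hL]
  simp only [List.reverse_cons, List.reverse_nil, List.nil_append, List.singleton_append, S]
  refine Finset.sum_congr rfl fun i hi => ?_
  simp only [Finset.mem_range] at hi
  rw [Finset.sum_range_succ, Finset.sum_eq_zero, zero_add]
  · congr 1
    rw [Finset.sum_range_succ', Finset.sum_eq_zero, zero_add]
    · rw [Finset.sum_range_succ, Finset.sum_eq_zero, zero_add]
      · have h1 : (L.take i).length = i := by simp; omega
        have h2 : (L.drop i).take (L.length - i) = L.drop i := by rw [List.take_of_length_le]; simp
        have h3 : L.drop (i + (L.length - i)) = [] := by rw [List.drop_of_length_le]; omega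
        have h4 : (L.take i).drop i = [] := by rw [List.drop_of_length_le]; omega
        rw [h2, h3]
        simp only [h1]
        simp [h4, List.take_take]
      · intro r hr
        rw [O.m_van, smul_zero]
        simp at hr
        simp; omega
    · intro j hj
      apply Finset.sum_eq_zero
      intro r hr
      rw [O.m_van, smul_zero]
      simp at hr hj
      simp; omega
  · intro r hr
    rw [Finset.sum_eq_zero, smul_zero]
    intro j hj
    apply Finset.sum_eq_zero
    intro s hs
    rw [O.m_van, smul_zero]
    simp at hr
    simp
    omega

theorem xm_pj {x : ℤ × A} {L : List (ℤ × A)} (hx : x.2 ∈ O.gz x.1) (hL : O.HL L) :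
    (O.bl (O.bl x [(2, m)]) L).2 = ∑ r ∈ Finset.range 3, ∑ i ∈ Finset.range (L.length + 1 - r),
      sgn K (sd (L.take i)) •
        (O.bl x (L.take i ++ O.bl (2, m) ((L.drop i).take r) :: L.drop (i + r))).2 := by
  rw [O.one_pj hx hm hL]
  rw [Finset.sum_comm' (t' := Finset.range (L.length + 1)) (s' := fun r => Finset.range (L.length + 1 - r))
    (h := by intro i r; simp; omega)]
  have e : ∀ i : ℕ, (((2, m) : ℤ × A).1 - 1) * sd (L.take i) = sd (L.take i) := fun i => by norm_num
  simp only [e]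
  set g : ℕ → A := fun r => ∑ i ∈ Finset.range (L.length + 1 - r),
      sgn K (sd (L.take i)) •
        (O.bl x (L.take i ++ O.bl (2, m) ((L.drop i).take r) :: L.drop (i + r))).2 with hg
  have h1 : ∀ r, L.length + 1 ≤ r → g r = 0 := by
    intro r hr
    simp only [hg]
    rw [Nat.sub_eq_zero_of_le hr]; simp
  have h2 : ∀ r, 3 ≤ r → g r = 0 := by
    intro r hr
    simp only [hg]
    apply Finset.sum_eq_zero
    intro i hi
    simp only [Finset.mem_range] at hi
    rw [O.bl_list_zero, smul_zero]
    apply O.m_van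
    simp; omega
  change ∑ r ∈ Finset.range (L.length + 1), g r = ∑ r ∈ Finset.range 3, g r
  rcases le_total (L.length + 1) 3 with h | h
  · apply Finset.sum_subset (Finset.range_mono h)
    intro r _ hr
    simp only [Finset.mem_range, not_lt] at hr
    exact h1 r hr
  · symm
    apply Finset.sum_subset (Finset.range_mono h)
    intro r _ hr
    simp only [Finset.mem_range, not_lt] at hr
    exact h2 r hr

theorem S_m (ys : List (ℤ × A)) (F : List (ℤ × A) → A) :
    O.S ys.reverse [(2, m)] F = ∑ i ∈ Finset.range (ys.length + 1),
        sgn K (sd (ys.drop i)) • F (ys.take i ++ (2, m) :: ys.drop i) +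
      ∑ i ∈ Finset.range ys.length, sgn K (sd (ys.drop (i + 1))) • F (ys.take i ++ O.bl (ys.getD i 0) [(2, m)] :: ys.drop (i + 1)) := by
  have hnil : ∀ (ys : List (ℤ × A)) (F : List (ℤ × A) → A), O.S ys.reverse [] F = F ys := by
    intro ys
    induction ys using List.reverseRecOn with
    | nil => intro F; simp [S]
    | append_singleton ys y ih => intro F; simp [S_nil, ih]
  induction ys using List.reverseRecOn generalizing F with
  | nil => simp [S]
  | append_singleton ys y ih =>
    rw [List.reverse_append, List.reverse_singleton, List.singleton_append]
    have hc := O.S_concat y ys.reverse [] (2, m) F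
    simp only [List.nil_append] at hc
    rw [hc, S_nil, hnil]
    have hl : (ys ++ [y]).length = ys.length + 1 := by simp
    have hd : ∀ i, i ≤ ys.length → (ys ++ [y]).drop i = ys.drop i ++ [y] := fun i hi => by
      rw [List.drop_append_of_le_length hi]
    have ht : ∀ i, i ≤ ys.length → (ys ++ [y]).take i = ys.take i := fun i hi => by
      rw [List.take_append_of_le_length hi]
    rw [hl, Finset.sum_range_succ _ (ys.length + 1)]
    have e1 : ∑ i ∈ Finset.range (ys.length + 1), sgn K (sd ((ys ++ [y]).drop i)) •
        F ((ys ++ [y]).take i ++ (2, m) :: (ys ++ [y]).drop i) = ∑ i ∈ Finset.range (ys.length + 1),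
          sgn K (y.1 - 1) • sgn K (sd (ys.drop i)) • F (ys.take i ++ (2, m) :: ys.drop i ++ [y]) := by
      refine Finset.sum_congr rfl fun i hi => ?_
      simp only [Finset.mem_range] at hi
      rw [hd i (by omega), ht i (by omega), sgn_smul_smul]
      simp only [sd_append, sd_cons, sd_nil, List.append_assoc, List.cons_append]
      congr 2
      ring
    have e2 : ∑ i ∈ Finset.range (ys.length + 1), sgn K (sd ((ys ++ [y]).drop (i + 1))) •
        F ((ys ++ [y]).take i ++ O.bl ((ys ++ [y]).getD i 0) [(2, m)] :: (ys ++ [y]).drop (i + 1)) =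
        ∑ i ∈ Finset.range ys.length, sgn K (y.1 - 1) • sgn K (sd (ys.drop (i + 1))) •
        F (ys.take i ++ O.bl (ys.getD i 0) [(2, m)] :: ys.drop (i + 1) ++ [y]) +
        sgn K (sd ((ys ++ [y]).drop (ys.length + 1))) •
        F ((ys ++ [y]).take ys.length ++ O.bl ((ys ++ [y]).getD ys.length 0) [(2, m)] :: (ys ++ [y]).drop (ys.length + 1)) := by
      rw [Finset.sum_range_succ]
      congr 1
      refine Finset.sum_congr rfl fun i hi => ?_
      simp only [Finset.mem_range] at hi
      rw [hd (i + 1) (by omega), ht i (by omega), sgn_smul_smul, List.getD_append _ _ _ _ hi]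
      simp only [sd_append, sd_cons, sd_nil, List.append_assoc, List.cons_append]
      congr 2
      ring
    rw [e1, e2, ← Finset.smul_sum, ← Finset.smul_sum]
    simp only [List.nil_append, List.length_nil, Finset.sum_range_succ _ 1, Finset.sum_range_one, zero_add,
      List.take_zero, List.drop_zero, List.take_succ_cons, List.drop_succ_cons, bl_nil, sd_nil, mul_zero, sgn_zero, one_smul, hnil, ih]
    have e3 : (ys ++ [y]).getD ys.length 0 = y := by simp
    have e4 : (ys ++ [y]).drop (ys.length + 1) = [] := by rw [List.drop_of_length_le]; simp
    have e5 : (ys ++ [y]).take (ys.length + 1) = ys ++ [y] := by rw [List.take_of_length_le]; simp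
    rw [e3, e4, e5, ht _ le_rfl]
    have e6 : (y.1 - 1) * sd [((2, m) : ℤ × A)] = y.1 - 1 := by simp
    rw [e6, List.take_length]
    simp only [sd_nil, sgn_zero, one_smul, smul_add]
    abel

theorem xL_m {x : ℤ × A} {L : List (ℤ × A)} (hx : x.2 ∈ O.gz x.1) (hL : O.HL L) :
    (O.bl (O.bl x L) [(2, m)]).2 = ∑ i ∈ Finset.range (L.length + 1),
        sgn K (sd (L.drop i)) • (O.bl x (L.take i ++ (2, m) :: L.drop i)).2 +
      ∑ i ∈ Finset.range L.length, sgn K (sd (L.drop (i + 1))) •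
        (O.bl x (L.take i ++ O.bl (L.getD i 0) [(2, m)] :: L.drop (i + 1))).2 := by
  rw [O.preJac hx hL (by simpa [HL] using hm), O.S_m hm]

theorem split3 (L : List (ℤ × A)) (i : ℕ) (hi : i < L.length) : L.drop i = L.getD i 0 :: L.drop (i + 1) := by
  rw [List.drop_eq_getElem_cons hi, List.getD_eq_getElem _ _ hi]

/-- the higher homotopy relation on lists -/
theorem hom_list {x : ℤ × A} {L : List (ℤ × A)} {n : ℕ} (hn : L.length = n + 1) (hx : x.2 ∈ O.gz x.1) (hL : O.HL L) :
    (O.D (2, m) (O.bl x L)).2 - (O.bl (O.D (2, m) x) L).2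
      - ∑ i ∈ Finset.range (n + 1), sgn K (x.1 + 1 + sd (L.take i)) •
        (O.bl x (L.take i ++ O.D (2, m) (L.getD i 0) :: L.drop (i + 1))).2 =
    sgn K (x.1 * ((L.getD 0 0).1 + 1)) • (O.C (2, m) (L.getD 0 0) (O.bl x (L.drop 1))).2
    - ∑ i ∈ Finset.range n, sgn K (x.1 + 1 + sd (L.take (i + 1))) •
        (O.bl x (L.take i ++ O.C (2, m) (L.getD i 0) (L.getD (i + 1) 0) :: L.drop (i + 2))).2
    + sgn K (x.1 + 1 + sd (L.take n)) • (O.C (2, m) (O.bl x (L.take n)) (L.getD n 0)).2 := by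
  have h1 : (O.bl (O.D (2, m) x) L).2 = (O.bl (O.bl (2, m) [x]) L).2 + sgn K x.1 • (O.bl (O.bl x [(2, m)]) L).2 := by
    have a1 : O.bl (2, m) [x] = (x.1 + 1, (O.bl (2, m) [x]).2) := by
      apply Prod.ext
      · simp; ring
      · rfl
    have a2 : O.bl x [(2, m)] = (x.1 + 1, (O.bl x [(2, m)]).2) := by
      apply Prod.ext
      · simp
      · rfl
    rw [a1, a2]
    simp only [D, bl_add, bl_smul]
  have h2 : (O.D (2, m) (O.bl x L)).2 = (O.bl (2, m) [O.bl x L]).2 + sgn K (x.1 + sd L) • (O.bl (O.bl x L) [(2, m)]).2 := by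
    simp [D]
  rw [h1, h2, O.xL_m hm hx hL, O.xm_pj hm hx hL, O.mx_pj hm hn hx hL]
  simp only [Finset.sum_range_succ _ 2, Finset.sum_range_succ _ 1, Finset.sum_range_one, hn]
  have c0 : sgn K (x.1 + sd L) • ∑ i ∈ Finset.range (n + 1 + 1), sgn K (sd (L.drop i)) • (O.bl x (L.take i ++ (2, m) :: L.drop i)).2
      = sgn K x.1 • ∑ i ∈ Finset.range (n + 1 + 1 - 0), sgn K (sd (L.take i)) •
        (O.bl x (L.take i ++ O.bl (2, m) ((L.drop i).take 0) :: L.drop (i + 0))).2 := by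
    rw [Finset.smul_sum, Finset.smul_sum]
    refine Finset.sum_congr rfl fun i hi => ?_
    rw [sgn_smul_smul, sgn_smul_smul]
    simp only [List.take_zero, bl_nil, add_zero]
    congr 1
    apply sgn_congr
    have : sd L = sd (L.take i) + sd (L.drop i) := by rw [← sd_append, List.take_append_drop]
    rw [this]
    push_cast
    have h2 : ∀ a : ZMod 2, a + a = 0 := by decide
    linear_combination h2 (sd (L.drop i) : ZMod 2)
  have c1 : sgn K (x.1 + sd L) • ∑ i ∈ Finset.range (n + 1), sgn K (sd (L.drop (i + 1))) •
        (O.bl x (L.take i ++ O.bl (L.getD i 0) [(2, m)] :: L.drop (i + 1))).2 - 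
      sgn K x.1 • ∑ i ∈ Finset.range (n + 1 + 1 - 1), sgn K (sd (L.take i)) •
        (O.bl x (L.take i ++ O.bl (2, m) ((L.drop i).take 1) :: L.drop (i + 1))).2 = 
      ∑ i ∈ Finset.range (n + 1), sgn K (x.1 + 1 + sd (L.take i)) •
        (O.bl x (L.take i ++ O.D (2, m) (L.getD i 0) :: L.drop (i + 1))).2 := by
    rw [Finset.smul_sum, Finset.smul_sum, Nat.add_sub_cancel, ← Finset.sum_sub_distrib]
    refine Finset.sum_congr rfl fun i hi => ?_
    simp only [Finset.mem_range] at hi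
    have hs := split3 O hm L i (by omega)
    have e1 : (L.drop i).take 1 = [L.getD i 0] := by rw [hs]; simp
    have e2 : sd L = sd (L.take i) + (((L.getD i 0).1 - 1) + sd (L.drop (i + 1))) := by
      rw [← sd_cons, ← hs, ← sd_append, List.take_append_drop]
    rw [e1, e2]
    generalize L.getD i 0 = Z
    have a1 : O.bl (2, m) [Z] = (Z.1 + 1, (O.bl (2, m) [Z]).2) := by
      apply Prod.ext
      · simp; ring
      · rfl
    have a2 : O.bl Z [(2, m)] = (Z.1 + 1, (O.bl Z [(2, m)]).2) := by
      apply Prod.ext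
      · simp
      · rfl
    rw [a1, a2]
    simp only [D, bl_list_add, bl_list_smul, sgn_smul_smul, smul_add]
    rw [sub_eq_add_neg, sgn_neg_smul, add_comm]
    congr 2
    · congr 1; ring
    · apply sgn_congr
      push_cast
      have h2 : ∀ a : ZMod 2, a + a = 0 := by decide
      linear_combination h2 (sd (L.drop (i + 1)) : ZMod 2) - h2 1
  have c2 : sgn K x.1 • ∑ i ∈ Finset.range (n + 1 + 1 - 2), sgn K (sd (L.take i)) •
        (O.bl x (L.take i ++ O.bl (2, m) ((L.drop i).take 2) :: L.drop (i + 2))).2 = 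
       ∑ i ∈ Finset.range n, sgn K (x.1 + 1 + sd (L.take (i + 1))) •
        (O.bl x (L.take i ++ O.C (2, m) (L.getD i 0) (L.getD (i + 1) 0) :: L.drop (i + 2))).2 := by
    rw [Finset.smul_sum]
    have : n + 1 + 1 - 2 = n := by omega
    rw [this]
    refine Finset.sum_congr rfl fun i hi => ?_
    simp only [Finset.mem_range] at hi
    have hs := split3 O hm L i (by omega)
    have hs' := split3 O hm L (i + 1) (by omega)
    have e1 : (L.drop i).take 2 = [L.getD i 0, L.getD (i + 1) 0] := by rw [hs, hs']; simp
    have e2 : L.take (i + 1) = L.take i ++ [L.getD i 0] := by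
      rw [List.take_add, hs]; simp
    rw [e1, e2]
    generalize L.getD i 0 = Z
    generalize L.getD (i + 1) 0 = Z'
    have a1 : O.bl (2, m) [Z, Z'] = (Z.1 + Z'.1, (O.bl (2, m) [Z, Z']).2) := by
      apply Prod.ext
      · simp; ring
      · rfl
    rw [a1]
    simp only [C, bl_list_smul, sgn_smul_smul, sd_append, sd_cons, sd_nil]
    congr 1
    apply sgn_congr
    push_cast
    have h2 : ∀ a : ZMod 2, a + a = 0 := by decide
    linear_combination - h2 (Z.1 : ZMod 2)
  have c3 : sgn K (x.1 * ((L.getD 0 0).1 + 1)) • (O.C (2, m) (L.getD 0 0) (O.bl x (L.drop 1))).2 =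
      - (sgn K ((x.1 - 1) * sd (L.take 1)) • (O.bl (2, m) (L.take 1 ++ [O.bl x (L.drop 1)])).2) := by
    have hs := split3 O hm L 0 (by omega)
    have e1 : L.take 1 = [L.getD 0 0] := by
      have : L.take 1 = (L.drop 0).take 1 := by simp
      rw [this, hs]; simp
    rw [e1]
    generalize L.getD 0 0 = Z
    simp only [C, sgn_smul_smul, sgn_neg_smul, sd_cons, sd_nil, List.singleton_append]
    congr 1
    apply sgn_congr
    push_cast
    generalize (x.1 : ZMod 2) = a
    generalize (Z.1 : ZMod 2) = b
    revert a b
    decide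
  have c4 : sgn K (x.1 + 1 + sd (L.take n)) • (O.C (2, m) (O.bl x (L.take n)) (L.getD n 0)).2 = 
      - (O.bl (2, m) (O.bl x (L.take n) :: L.drop n)).2 := by
    have hs := split3 O hm L n (by omega)
    have e1 : L.drop (n + 1) = [] := by rw [List.drop_of_length_le]; omega
    rw [hs, e1]
    simp only [C, sgn_smul_smul, bl_fst]
    have : sgn K (x.1 + 1 + sd (L.take n) + (x.1 + sd (L.take n))) = sgn K 1 := by
      apply sgn_congr
      push_cast
      generalize (x.1 : ZMod 2) = a
      generalize (sd (L.take n) : ZMod 2) = b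
      revert a b
      decide
    rw [this, sgn_one]; simp
  rw [c3, c4, ← c1, ← c2, smul_add, c0, smul_add, smul_add]
  abel

end NsOperad
namespace NsOperad
variable (O : NsOperad K A)

theorem sgn_eq (K : Type u) [Field K] {a b : ℤ} (h : (a : ZMod 2) = (b : ZMod 2)) (x : A) [Module K A] : sgn K a • x = sgn K b • x := by
  rw [sgn_congr K h]

variable {m : A} (hm : m ∈ O.gz 2) (h0 : (O.bl (2, m) [(2, m)]).2 = 0)
include hm h0

theorem mm_pj {L : List (ℤ × A)} {n : ℕ} (hn : L.length = n + 1) (hL : O.HL L) :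
    (O.bl (2, m) [O.bl (2, m) L]).2 +
      sgn K (sd (L.take 1)) • (O.bl (2, m) (L.take 1 ++ [O.bl (2, m) (L.drop 1)])).2 +
      (O.bl (2, m) (O.bl (2, m) (L.take n) :: L.drop n)).2 = 0 := by
  have := O.mx_pj hm (x := (2, m)) hn hm hL
  rw [O.bl_zero _ h0] at this
  rw [this]
  norm_num

theorem D_sq {x : ℤ × A} (hx : x.2 ∈ O.gz x.1) : (O.D (2, m) (O.D (2, m) x)).2 = 0 := by
  have hxL : O.HL [x] := by simpa [HL] using hx
  have hmL : O.HL [(2, m)] := by simpa [HL] using hm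
  have e1 := O.mm_pj hm h0 (L := [x]) (n := 0) rfl hxL
  have e2 := O.mx_pj hm (L := [(2, m)]) (n := 0) rfl hx hmL
  have e3 := O.xm_pj hm (L := [(2, m)]) hx hmL
  have a1 : O.bl (2, m) [x] = (x.1 + 1, (O.bl (2, m) [x]).2) := by
    apply Prod.ext
    · simp; ring
    · rfl
  have a2 : O.bl x [(2, m)] = (x.1 + 1, (O.bl x [(2, m)]).2) := by
    apply Prod.ext
    · simp
    · rfl
  have h3 : (O.bl x [O.bl (2, m) [(2, m)]]).2 = 0 := O.bl_list_zero x [] [] _ h0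
  simp [Finset.sum_range_succ, h3, sgn_one] at e3
  simp at e2
  simp at e1
  have l1 : (O.bl (2, m) [O.D (2, m) x]).2 = (O.bl (2, m) [O.bl (2, m) [x]]).2 + sgn K x.1 • (O.bl (2, m) [O.bl x [(2, m)]]).2 := by
    rw [a1, a2]
    have := O.bl_list_add (2, m) [] [] (x.1 + 1) (O.bl (2, m) [x]).2 (sgn K x.1 • (O.bl x [(2, m)]).2)
    have h' := O.bl_list_smul (2, m) [] [] (x.1 + 1) (sgn K x.1) (O.bl x [(2, m)]).2
    simp only [List.nil_append] at this h'
    rw [← h', ← this]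
    rfl
  have l2 : (O.bl (O.D (2, m) x) [(2, m)]).2 = (O.bl (O.bl (2, m) [x]) [(2, m)]).2 + sgn K x.1 • (O.bl (O.bl x [(2, m)]) [(2, m)]).2 := by
    rw [a1, a2]
    simp only [D, bl_add, bl_smul]
  have : (O.D (2, m) (O.D (2, m) x)).2 = (O.bl (2, m) [O.D (2, m) x]).2 + sgn K (x.1 + 1) • (O.bl (O.D (2, m) x) [(2, m)]).2 := rfl
  rw [this, l1, l2, e2, e3]
  simp only [smul_zero, add_zero, smul_add, sgn_smul_smul]
  have r1 : sgn K (x.1 + 1) • (O.bl (2, m) [O.bl x [(2, m)]]).2 = - (sgn K x.1 • (O.bl (2, m) [O.bl x [(2, m)]]).2) := by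
    rw [sgn_neg_smul]
  have r2 : ∀ v : A, sgn K (x.1 + 1) • v = sgn K (x.1 - 1) • v := fun v => by
    apply sgn_eq
    push_cast
    generalize (x.1 : ZMod 2) = a
    revert a; decide
  have r3 : ∀ v : A, sgn K (x.1 + 1 + (x.1 - 1)) • v = v := fun v => by
    rw [← one_smul K v, ← sgn_zero K, sgn_smul_smul]
    apply sgn_eq
    push_cast
    generalize (x.1 : ZMod 2) = a
    revert a; decide
  rw [r1, r2, r3]
  rw [← e1]
  abel

theorem C_assoc {X Y Z : ℤ × A} (hX : X.2 ∈ O.gz X.1) (hY : Y.2 ∈ O.gz Y.1) (hZ : Z.2 ∈ O.gz Z.1) :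
    (O.C (2, m) (O.C (2, m) X Y) Z).2 = (O.C (2, m) X (O.C (2, m) Y Z)).2 := by
  have e1 := O.mm_pj hm h0 (L := [X, Y, Z]) (n := 2) rfl (by simp [HL, hX, hY, hZ])
  have e2 : (O.bl (2, m) [O.bl (2, m) [X, Y, Z]]).2 = 0 :=
    O.bl_list_zero (2, m) [] [] _ (O.m_van m (by simp))
  rw [e2] at e1
  simp at e1
  have a1 : ∀ X Y : ℤ × A, O.bl (2, m) [X, Y] = (X.1 + Y.1, (O.bl (2, m) [X, Y]).2) := by
    intro X Y
    apply Prod.ext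
    · simp; ring
    · rfl
  have h1 := O.bl_list_smul (2, m) [] [Z] (X.1 + Y.1) (sgn K X.1) (O.bl (2, m) [X, Y]).2
  have h2 := O.bl_list_smul (2, m) [X] [] (Y.1 + Z.1) (sgn K Y.1) (O.bl (2, m) [Y, Z]).2
  rw [← a1] at h1 h2
  simp only [C]
  simp only [List.nil_append, List.singleton_append] at h1 h2
  rw [h1, h2]
  rw [add_eq_zero_iff_neg_eq, sgn_neg_smul] at e1
  rw [← e1]
  simp only [sgn_smul_smul]
  apply sgn_eq
  push_cast
  generalize (X.1 : ZMod 2) = a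
  generalize (Y.1 : ZMod 2) = b
  revert a b
  decide

theorem C_leib {X Y : ℤ × A} (hX : X.2 ∈ O.gz X.1) (hY : Y.2 ∈ O.gz Y.1) :
    (O.D (2, m) (O.C (2, m) X Y)).2 = (O.C (2, m) (O.D (2, m) X) Y).2 + sgn K X.1 • (O.C (2, m) X (O.D (2, m) Y)).2 := by
  have hL : O.HL [X, Y] := by simp [HL, hX, hY]
  have e1 := O.mm_pj hm h0 (L := [X, Y]) (n := 1) rfl hL
  have e2 := O.hom_list hm (x := (2, m)) (L := [X, Y]) (n := 1) rfl hm hL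
  have dm : (O.D (2, m) (2, m)).2 = 0 := by simp [D, h0]
  rw [O.bl_zero _ dm] at e2
  have a1 : O.bl (2, m) [X, Y] = (X.1 + Y.1, (O.bl (2, m) [X, Y]).2) := by
    apply Prod.ext
    · simp; ring
    · rfl
  have h1 : (O.D (2, m) (O.C (2, m) X Y)).2 = sgn K X.1 • (O.D (2, m) (O.bl (2, m) [X, Y])).2 := by
    have h2 := O.bl_list_smul (2, m) [] [] (X.1 + Y.1) (sgn K X.1) (O.bl (2, m) [X, Y]).2
    have h3 := O.bl_smul (X.1 + Y.1) (sgn K X.1) (O.bl (2, m) [X, Y]).2 [(2, m)]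
    rw [a1]
    simp only [List.nil_append] at h2
    simp only [C, D]
    rw [h2, h3, smul_add, smul_comm (sgn K X.1) (sgn K (X.1 + Y.1))]
  have h4 : (O.bl (2, m) [O.C (2, m) X Y]).2 = sgn K X.1 • (O.bl (2, m) [O.bl (2, m) [X, Y]]).2 := by
    have h2 := O.bl_list_smul (2, m) [] [] (X.1 + Y.1) (sgn K X.1) (O.bl (2, m) [X, Y]).2
    rw [← a1] at h2
    exact h2
  simp only [Finset.sum_range_succ, Finset.sum_range_zero, List.take, List.drop, List.getD_cons_zero, List.getD_cons_succ, List.nil_append, List.cons_append, zero_add, h4] at e1 e2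
  simp at e1 e2
  have s3 : sgn K 3 = -1 := by
    rw [← sgn_one K]; exact sgn_congr K (by decide)
  have s2 : sgn K (2 * (X.1 + 1)) = 1 := by
    rw [← sgn_zero K]; apply sgn_congr; push_cast
    generalize (X.1 : ZMod 2) = a
    revert a; decide
  have s4 : sgn K (3 + (X.1 - 1)) = sgn K X.1 := by
    apply sgn_congr; push_cast
    generalize (X.1 : ZMod 2) = a
    revert a; decide
  have s1 : sgn K (X.1 + 1) = - sgn K X.1 := by
    rw [sgn_add, sgn_one]; ring
  have s5 : sgn K (X.1 - 1) = - sgn K X.1 := by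
    rw [← s1]; apply sgn_congr; push_cast
    generalize (X.1 : ZMod 2) = a
    revert a; decide
  have ss : sgn K X.1 * sgn K X.1 = 1 := by
    rw [← sgn_add, ← sgn_zero K]; apply sgn_congr; push_cast
    generalize (X.1 : ZMod 2) = a
    revert a; decide
  have c1 : (O.C (2, m) (O.bl (2, m) [X]) Y).2 = - sgn K X.1 • (O.bl (2, m) [O.bl (2, m) [X], Y]).2 := by
    rw [← s1]
    simp only [C]
    apply sgn_eq
    simp
    generalize (X.1 : ZMod 2) = a
    revert a; decide
  have c2 : (O.C (2, m) (O.D (2, m) X) Y).2 = - sgn K X.1 • (O.bl (2, m) [O.D (2, m) X, Y]).2 := by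
    rw [← s1]
    rfl
  have c3 : ∀ Z, (O.C (2, m) X Z).2 = sgn K X.1 • (O.bl (2, m) [X, Z]).2 := fun Z => rfl
  rw [s5] at e1
  rw [s3, s4, s2, c1, c3] at e2
  rw [h1, c2, c3]
  generalize sgn K X.1 = s at *
  have e3 : (O.D (2, m) (O.bl (2, m) [X, Y])).2 = - (O.bl (2, m) [O.D (2, m) X, Y]).2 + s • (O.bl (2, m) [X, O.D (2, m) Y]).2 := by
    rw [← sub_eq_zero, ← neg_eq_zero, ← e1]
    simp only [smul_smul, mul_neg, ss] at e2
    linear_combination (norm := module) (-1 : K) • e2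
  rw [e3]
  module

end NsOperad
namespace NsOperad
variable (O : NsOperad K A)

theorem sd_take_Lf {n : ℕ} (f : Fin n → ℤ) (y : Fin n → A) (k : ℕ) :
    (sd ((Lf f y).take k) : ZMod 2) =
      ((∑ p ∈ Finset.univ.filter (fun p : Fin n => (p : ℕ) < k), (f p + 1) : ℤ) : ZMod 2) := by
  have : sd ((Lf f y).take k) = ∑ p ∈ Finset.univ.filter (fun p : Fin n => (p : ℕ) < k), (f p - 1) := by
    rw [sd, Lf, List.map_take, List.map_ofFn, List.sum_take_ofFn]
    rfl
  rw [this]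
  push_cast
  refine Finset.sum_congr rfl fun p _ => ?_
  generalize (f p : ZMod 2) = a
  revert a; decide

theorem mu_grade {k : ℕ} (d : ℤ) (e : Fin k → ℤ) (x : A) (y : Fin k → A)
    (hx : x ∈ O.gz d) (hy : ∀ i, y i ∈ O.gz (e i)) :
    O.mu k x y ∈ O.gz (d + ∑ i, (e i - 1)) := by
  rw [O.mu_bl hx hy]
  have := O.bl_gz (y := (d, x)) hx (O.HL_Lf e y hy)
  rwa [bl_fst, sd_Lf] at this

theorem mu_zero (x : A) : O.mu 0 x ![] = x := by
  induction x using O.hom_ind with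
  | h0 a x hx =>
    rw [O.mu_bl (q := ![]) hx (fun l => l.elim0)]
    simp [Lf, bl_nil]
  | ha x y hx hy => rw [map_add, add_apply, hx, hy]

variable {m : A} (hm : m ∈ O.gz 2)
include hm

theorem dd_grade (a : ℤ) (x : A) (hx : x ∈ O.gz a) : O.dd m x ∈ O.gz (a + 1) := by
  rw [O.dd_eq hm hx]
  exact O.D_gz hm (X := (a, x)) hx

theorem cup_grade (a b : ℤ) (x y : A) (hx : x ∈ O.gz a) (hy : y ∈ O.gz b) :
    O.cup m x y ∈ O.gz (a + b) := by
  rw [O.cup_eq hm hx hy]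
  exact O.C_gz hm (X := (a, x)) (Y := (b, y)) hx hy

theorem D_dd {a : ℤ} {x : A} (hx : x ∈ O.gz a) : O.D (2, m) (a, x) = (a + 1, O.dd m x) := by
  rw [O.dd_eq hm hx]; rfl

theorem C_cup {a b : ℤ} {x y : A} (hx : x ∈ O.gz a) (hy : y ∈ O.gz b) :
    O.C (2, m) (a, x) (b, y) = (a + b, O.cup m x y) := by
  rw [O.cup_eq hm hx hy]; rfl

theorem distrib_aux (n : ℕ) (b : ℤ) (f : Fin n → ℤ) (x₁ x₂ : A) (y : Fin n → A)
    (h2 : x₂ ∈ O.gz b) (hy : ∀ i, y i ∈ O.gz (f i)) :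
    O.mu n (O.cup m x₁ x₂) y =
      ∑ k : Fin (n + 1),
        sgn K (b * ∑ p ∈ Finset.univ.filter (fun p : Fin n => (p : ℕ) < (k : ℕ)), (f p + 1)) •
          O.cup m (O.mu (k : ℕ) x₁ (fun i : Fin (k : ℕ) => y (Fin.castLE (Nat.lt_succ_iff.mp k.isLt) i)))
              (O.mu (n - (k : ℕ)) x₂ (fun i : Fin (n - (k : ℕ)) =>
                y ⟨(k : ℕ) + (i : ℕ), by have := i.isLt; omega⟩)) := by
  induction x₁ using O.hom_ind with
  | ha x y hx hy =>
    simp only [map_add, LinearMap.add_apply, add_apply, hx, hy, smul_add, Finset.sum_add_distrib]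
  | h0 a x hx =>
    have e := O.mxy_pj hm (x := (a, x)) (y := (b, x₂)) (L := Lf f y) hx h2 (O.HL_Lf f y hy)
    rw [O.mu_bl (O.cup_grade hm a b x x₂ hx h2) hy, ← O.C_cup hm hx h2]
    have a1 : O.bl (2, m) [(a, x), (b, x₂)] = (a + b, (O.bl (2, m) [(a, x), (b, x₂)]).2) := by
      apply Prod.ext
      · simp; ring
      · rfl
    rw [a1] at e
    simp only [C]
    rw [O.bl_smul, e, Lf_length, Finset.sum_range, Finset.smul_sum]
    refine Finset.sum_congr rfl fun k _ => ?_
    have hk : (k : ℕ) ≤ n := Nat.lt_succ_iff.mp k.isLt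
    have t1 : (Lf f y).take k = Lf (fun i : Fin (k : ℕ) => f (Fin.castLE hk i)) (fun i : Fin (k : ℕ) => y (Fin.castLE hk i)) := by
      apply List.ext_getElem
      · simp [hk]
      · intro n h1 h2
        simp [Lf]
    have t2 : (Lf f y).drop k = Lf (fun i : Fin (n - (k : ℕ)) => f ⟨(k : ℕ) + (i : ℕ), by have := i.isLt; omega⟩)
        (fun i : Fin (n - (k : ℕ)) => y ⟨(k : ℕ) + (i : ℕ), by have := i.isLt; omega⟩) := by
      apply List.ext_getElem
      · simp
      · intro n h1 h2
        simp [Lf]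
    have hy1 : ∀ i : Fin (k : ℕ), y (Fin.castLE hk i) ∈ O.gz (f (Fin.castLE hk i)) := fun i => hy _
    have hy2 : ∀ i : Fin (n - (k : ℕ)), y ⟨(k : ℕ) + (i : ℕ), by have := i.isLt; omega⟩ ∈ O.gz (f ⟨(k : ℕ) + (i : ℕ), by have := i.isLt; omega⟩) := fun i => hy _
    have g1 := O.mu_grade _ _ _ _ hx hy1
    have g2 := O.mu_grade _ _ _ _ h2 hy2
    rw [O.cup_eq hm g1 g2, O.mu_bl hx hy1, O.mu_bl h2 hy2, ← t1, ← t2]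
    rw [← sd_Lf _ (fun i : Fin (k : ℕ) => y (Fin.castLE hk i)), ← t1,
      ← sd_Lf _ (fun i : Fin (n - (k : ℕ)) => y ⟨(k : ℕ) + (i : ℕ), by have := i.isLt; omega⟩), ← t2]
    have hs : (sd ((Lf f y).take k) : ZMod 2) = ((∑ p ∈ Finset.univ.filter (fun p : Fin n => (p : ℕ) < (k : ℕ)), (f p + 1) : ℤ) : ZMod 2) := by
      rw [sd_take_Lf]
    simp only [C, sgn_smul_smul]
    have u1 : O.bl (a, x) ((Lf f y).take k) = (a + sd ((Lf f y).take k), (O.bl (a, x) ((Lf f y).take k)).2) := Prod.ext (by simp) rfl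
    have u2 : O.bl (b, x₂) ((Lf f y).drop k) = (b + sd ((Lf f y).drop k), (O.bl (b, x₂) ((Lf f y).drop k)).2) := Prod.ext (by simp) rfl
    rw [← u1, ← u2]
    apply sgn_eq
    simp only [Int.cast_add, Int.cast_mul, Int.cast_sub, hs]
    generalize (((∑ p ∈ Finset.univ.filter (fun p : Fin n => (p : ℕ) < (k : ℕ)), (f p + 1) : ℤ)) : ZMod 2) = c
    generalize (a : ZMod 2) = a
    generalize (b : ZMod 2) = b
    simp only [Int.cast_one]
    revert a b c
    decide

end NsOperad
namespace NsOperad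
variable (O : NsOperad K A)

theorem Lf_getElem {k : ℕ} (q : Fin k → ℤ) (y : Fin k → A) (i : ℕ) (h : i < (Lf q y).length) :
    (Lf q y)[i] = (q ⟨i, by simpa using h⟩, y ⟨i, by simpa using h⟩) := by
  simp only [Lf, List.getElem_ofFn]

variable {m : A} (hm : m ∈ O.gz 2)
include hm

theorem homotopy_aux (n : ℕ) (a : ℤ) (f : Fin (n + 1) → ℤ) (x : A) (xs : Fin (n + 1) → A)
    (hx : x ∈ O.gz a) (hxs : ∀ i, xs i ∈ O.gz (f i)) :
    O.dd m (O.mu (n + 1) x xs) - O.mu (n + 1) (O.dd m x) xs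
      - ∑ i : Fin (n + 1),
          sgn K (a + 1 + ∑ j ∈ Finset.univ.filter (fun j : Fin (n + 1) => (j : ℕ) < (i : ℕ)), (f j + 1)) •
            O.mu (n + 1) x (Function.update xs i (O.dd m (xs i)))
    = sgn K (a * (f 0 + 1)) • O.cup m (xs 0) (O.mu n x (fun i : Fin n => xs i.succ))
      - ∑ i : Fin n,
          sgn K (a + 1 + ∑ j ∈ Finset.univ.filter (fun j : Fin (n + 1) => (j : ℕ) ≤ (i : ℕ)), (f j + 1)) •
            O.mu n x (fun t : Fin n =>
              if (t : ℕ) < (i : ℕ) then xs t.castSucc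
              else if (t : ℕ) = (i : ℕ) then O.cup m (xs t.castSucc) (xs t.succ)
              else xs t.succ)
      + sgn K (a + 1 + ∑ j ∈ Finset.univ.filter (fun j : Fin (n + 1) => (j : ℕ) < n), (f j + 1)) •
          O.cup m (O.mu n x (fun i : Fin n => xs i.castSucc)) (xs (Fin.last n)) := by
  have e := O.hom_list hm (x := (a, x)) (L := Lf f xs) (n := n) (Lf_length f xs) hx (O.HL_Lf f xs hxs)
  have hg : ∀ (i : ℕ) (hi : i < n + 1), (Lf f xs).getD i 0 = (f ⟨i, hi⟩, xs ⟨i, hi⟩) := by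
    intro i hi
    rw [List.getD_eq_getElem _ _ (by simpa using hi), Lf_getElem]
  have u : ∀ L : List (ℤ × A), O.bl (a, x) L = (a + sd L, (O.bl (a, x) L).2) := fun L =>
    Prod.ext (by simp) rfl
  have h1 : O.dd m (O.mu (n + 1) x xs) = (O.D (2, m) (O.bl (a, x) (Lf f xs))).2 := by
    have := O.mu_grade _ _ _ _ hx hxs
    rw [O.dd_eq hm this, O.mu_bl hx hxs, ← sd_Lf f xs, ← u]
  have h2 : O.mu (n + 1) (O.dd m x) xs = (O.bl (O.D (2, m) (a, x)) (Lf f xs)).2 := by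
    rw [O.mu_bl (O.dd_grade hm a x hx) hxs, O.D_dd hm hx]
  have h3 : ∀ i : Fin (n + 1), sgn K (a + 1 + ∑ j ∈ Finset.univ.filter (fun j : Fin (n + 1) => (j : ℕ) < (i : ℕ)), (f j + 1)) •
            O.mu (n + 1) x (Function.update xs i (O.dd m (xs i))) =
      sgn K (a + 1 + sd ((Lf f xs).take i)) • (O.bl (a, x) ((Lf f xs).take i ++ O.D (2, m) ((Lf f xs).getD i 0) :: (Lf f xs).drop (i + 1))).2 := by
    intro i
    rw [hg i i.isLt]
    simp only [Fin.eta]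
    rw [O.D_dd hm (hxs i), ← Lf_update, ← O.mu_bl hx]
    · apply sgn_eq
      rw [Int.cast_add, Int.cast_add _ (sd _), sd_take_Lf]
    · intro l
      by_cases h : l = i
      · subst h
        simpa using O.dd_grade hm _ _ (hxs l)
      · simpa [h] using hxs l
  have h4 : O.cup m (xs 0) (O.mu n x (fun i : Fin n => xs i.succ)) =
      (O.C (2, m) ((Lf f xs).getD 0 0) (O.bl (a, x) ((Lf f xs).drop 1))).2 := by
    have hq : ∀ i : Fin n, xs i.succ ∈ O.gz (f i.succ) := fun i => hxs _
    have t : (Lf f xs).drop 1 = Lf (fun i : Fin n => f i.succ) (fun i => xs i.succ) := by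
      simp [Lf, List.ofFn_succ]
    have := O.mu_grade _ _ _ _ hx hq
    rw [O.cup_eq hm (hxs 0) this, O.mu_bl hx hq, ← sd_Lf _ (fun i : Fin n => xs i.succ), ← t, ← u,
      hg 0 (Nat.succ_pos n)]
    rfl
  have h5 : O.cup m (O.mu n x (fun i : Fin n => xs i.castSucc)) (xs (Fin.last n)) =
      (O.C (2, m) (O.bl (a, x) ((Lf f xs).take n)) ((Lf f xs).getD n 0)).2 := by
    have hq : ∀ i : Fin n, xs i.castSucc ∈ O.gz (f i.castSucc) := fun i => hxs _
    have t : (Lf f xs).take n = Lf (fun i : Fin n => f i.castSucc) (fun i => xs i.castSucc) := by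
      apply List.ext_getElem
      · simp
      · intro i h1 h2
        rw [List.getElem_take, Lf_getElem, Lf_getElem]
        rfl
    have := O.mu_grade _ _ _ _ hx hq
    rw [O.cup_eq hm this (hxs _), O.mu_bl hx hq, ← sd_Lf _ (fun i : Fin n => xs i.castSucc), ← t, ← u,
      hg n (Nat.lt_succ_self n)]
    rfl
  have h6 : ∀ i : Fin n, sgn K (a + 1 + ∑ j ∈ Finset.univ.filter (fun j : Fin (n + 1) => (j : ℕ) ≤ (i : ℕ)), (f j + 1)) •
            O.mu n x (fun t : Fin n =>
              if (t : ℕ) < (i : ℕ) then xs t.castSucc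
              else if (t : ℕ) = (i : ℕ) then O.cup m (xs t.castSucc) (xs t.succ)
              else xs t.succ) =
      sgn K (a + 1 + sd ((Lf f xs).take (i + 1))) • (O.bl (a, x) ((Lf f xs).take i ++ O.C (2, m) ((Lf f xs).getD i 0) ((Lf f xs).getD (i + 1) 0) :: (Lf f xs).drop (i + 2))).2 := by
    intro i
    have hi := i.isLt
    rw [hg i (by omega), hg (i + 1) (by omega)]
    have hb : ∀ t : Fin n, (if (t : ℕ) < (i : ℕ) then xs t.castSucc
              else if (t : ℕ) = (i : ℕ) then O.cup m (xs t.castSucc) (xs t.succ)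
              else xs t.succ) ∈ O.gz (if (t : ℕ) < (i : ℕ) then f t.castSucc
              else if (t : ℕ) = (i : ℕ) then f t.castSucc + f t.succ
              else f t.succ) := by
      intro t
      split_ifs
      · exact hxs _
      · exact O.cup_grade hm _ _ _ _ (hxs _) (hxs _)
      · exact hxs _
    rw [O.mu_bl hx hb, O.C_cup hm (hxs _) (hxs _)]
    have t : Lf (fun t : Fin n => if (t : ℕ) < (i : ℕ) then f t.castSucc
              else if (t : ℕ) = (i : ℕ) then f t.castSucc + f t.succ
              else f t.succ) (fun t : Fin n => if (t : ℕ) < (i : ℕ) then xs t.castSucc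
              else if (t : ℕ) = (i : ℕ) then O.cup m (xs t.castSucc) (xs t.succ)
              else xs t.succ) = (Lf f xs).take i ++ (f ⟨i, by omega⟩ + f ⟨i + 1, by omega⟩, O.cup m (xs ⟨i, by omega⟩) (xs ⟨i + 1, by omega⟩)) :: (Lf f xs).drop (i + 2) := by
      apply List.ext_getElem
      · simp
        omega
      · intro j h1 h2
        rw [List.getElem_append]
        simp only [List.length_take, Lf_length]
        have hmin : min (i : ℕ) (n + 1) = i := by omega
        rw [Lf_getElem]
        rcases lt_trichotomy j i with h | h | h
        · rw [dif_pos (by omega), List.getElem_take, Lf_getElem]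
          simp only [if_pos h]
          rfl
        · subst h
          rw [dif_neg (by omega)]
          simp only [hmin, lt_irrefl, if_true, if_false, Nat.sub_self, List.getElem_cons_zero]
          rfl
        · rw [dif_neg (by omega)]
          obtain ⟨c, rfl⟩ := Nat.exists_eq_add_of_lt h
          have hc : ↑i + c + 1 - min (i : ℕ) (n + 1) = c + 1 := by omega
          simp only [hc, List.getElem_cons_succ, List.getElem_drop, Lf_getElem]
          have e1 : ¬ (↑i + c + 1 < (i : ℕ)) := by omega
          have e2 : ¬ (↑i + c + 1 = (i : ℕ)) := by omega
          have e3 : (⟨↑i + c + 1, by simpa using h1⟩ : Fin n).succ = ⟨↑i + 2 + c, by simp at h1; omega⟩ := by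
            apply Fin.ext; simp; omega
          simp only [if_neg e1, if_neg e2, e3]
    rw [t]
    apply sgn_eq
    rw [Int.cast_add, Int.cast_add _ (sd _), sd_take_Lf]
    simp only [Nat.lt_succ_iff]
  simp only [Finset.sum_range] at e
  rw [h1, h2, h4, h5, Finset.sum_congr rfl fun i _ => h3 i, Finset.sum_congr rfl fun i _ => h6 i]
  rw [e, hg 0 (Nat.succ_pos n)]
  congr 2
  apply sgn_congr
  rw [Int.cast_add, sd_take_Lf, ← Int.cast_add]

end NsOperad
namespace NsOperad
variable (O : NsOperad K A)

theorem brace_mm (m : A) : O.brace 2 ![2] m ![m] = O.comp 0 m m - O.comp 1 m m := by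
  rw [brace_eq]
  have : (Lf (fun l => ((![2] : Fin 1 → ℕ) l : ℤ)) ![m]).reverse = [(2, m)] := by simp [Lf]
  rw [this, show (2 : ℕ) = 0 + 1 + 1 from rfl, U_succ, U_succ]
  simp [sgn_one, sub_eq_add_neg]

theorem bl_mm (m : A) : (O.bl (2, m) [(2, m)]).2 = O.brace 2 ![2] m ![m] := by
  rw [brace_eq]
  simp [Lf, bl]

variable {m : A} (hm : m ∈ O.gz 2) (h0 : (O.bl (2, m) [(2, m)]).2 = 0)
include hm h0

theorem dd_sq (x : A) : O.dd m (O.dd m x) = 0 := by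
  induction x using O.hom_ind with
  | ha x y hx hy => simp [hx, hy]
  | h0 a x hx =>
    rw [O.dd_eq hm (O.dd_grade hm a x hx), ← O.D_dd hm hx]
    exact O.D_sq hm h0 (x := (a, x)) hx

theorem cup_assoc (x y z : A) : O.cup m (O.cup m x y) z = O.cup m x (O.cup m y z) := by
  induction x using O.hom_ind with
  | ha x y hx hy => simp only [map_add, LinearMap.add_apply, hx, hy]
  | h0 a x hx =>
    induction y using O.hom_ind with
    | ha x y hx hy => simp only [map_add, LinearMap.add_apply, hx, hy]
    | h0 b y hy =>
      induction z using O.hom_ind with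
      | ha x y hx hy => simp only [map_add, hx, hy]
      | h0 c z hz =>
        rw [O.cup_eq hm (O.cup_grade hm a b x y hx hy) hz, ← O.C_cup hm hx hy,
          O.cup_eq hm hx (O.cup_grade hm b c y z hy hz), ← O.C_cup hm hy hz]
        exact O.C_assoc hm h0 (X := (a, x)) (Y := (b, y)) (Z := (c, z)) hx hy hz

theorem dd_leib (a : ℤ) (x y : A) (hx : x ∈ O.gz a) :
    O.dd m (O.cup m x y) = O.cup m (O.dd m x) y + sgn K a • O.cup m x (O.dd m y) := by
  induction y using O.hom_ind with
  | ha x y hx hy =>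
    simp only [map_add, hx, hy, smul_add]
    abel
  | h0 b y hy =>
    rw [O.dd_eq hm (O.cup_grade hm a b x y hx hy), ← O.C_cup hm hx hy,
      O.cup_eq hm hx (O.dd_grade hm b y hy), ← O.D_dd hm hy,
      O.cup_eq hm (O.dd_grade hm a x hx) hy, ← O.D_dd hm hx]
    exact O.C_leib hm h0 (X := (a, x)) (Y := (b, y)) hx hy

/-- the brace B-infinity algebra -/
def toB : BraceBInfty K A where
  grading := O.gz
  decomp := O.gz_internal
  μ := O.mu
  μ_grade := O.mu_grade
  μ_zero := O.mu_zero
  pre_jacobi := O.isPreJacobi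
  d := O.dd m
  mul := O.cup m
  d_grade := O.dd_grade hm
  mul_grade := O.cup_grade hm
  d_sq := O.dd_sq hm h0
  mul_assoc' := O.cup_assoc hm h0
  leibniz := O.dd_leib hm h0
  distrib := O.distrib_aux hm
  homotopy := O.homotopy_aux hm

end NsOperad
end Core
/-! ### STATEMENT 4 -/

/-- **Gerstenhaber–Voronov operadic modeling, brace `B∞` part.**
Let `P` be a non-symmetric operad over `K` and `m ∈ P(2)`.  Then `m` is a multiplication
on `P` (i.e. `γ(m; m, id) = γ(m; id, m)`, equivalently `m ∘₁ m = m ∘₂ m`) if and only if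
`m{m} = 0` in `W_P`.  In that case, `W_P` with the cup product
`x ∪ y := (−1)^{|x|} m{x, y}`, the differential
`δ(x) := m{x} − (−1)^{|x|+1} x{m}`, and the operadic braces, is a brace `B∞` algebra. -/
theorem operad_multiplication_to_braceBInfty
    (K : Type u) [Field K] [CharZero K]
    (A : Type u) [AddCommGroup A] [Module K A]
    (O : NsOperad K A) (m : A) (hm : m ∈ O.grading 2) :
    -- (1) `m` is a multiplication iff `m{m} = 0`
    ((O.comp 0 m m = O.comp 1 m m) ↔ O.brace 2 ![2] m ![m] = 0) ∧
    -- (2) in that case, the induced structure is a brace `B∞` algebra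
    (O.comp 0 m m = O.comp 1 m m →
      ∃ B : BraceBInfty K A,
        (∀ n : ℕ, B.grading (n : ℤ) = O.grading n) ∧
        (∀ z : ℤ, z < 0 → B.grading z = ⊥) ∧
        -- braces: the operadic brace operations
        (∀ (p k : ℕ) (q : Fin k → ℕ) (x : A) (y : Fin k → A),
          x ∈ O.grading p → (∀ l, y l ∈ O.grading (q l)) →
          B.μ k x y = O.brace p q x y) ∧
        -- differential: `δ(x) = m{x} − (−1)^{|x|+1} x{m} = [m, x]_G`
        (∀ (a : ℕ) (x : A), x ∈ O.grading a →
          B.d x = O.brace 2 ![a] m ![x] - sgn K ((a : ℤ) + 1) • O.brace a ![2] x ![m]) ∧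
        -- cup product: `x ∪ y = (−1)^{|x|} m{x, y}`
        (∀ (a b : ℕ) (x y : A), x ∈ O.grading a → y ∈ O.grading b →
          B.mul x y = sgn K (a : ℤ) • O.brace 2 ![a, b] m ![x, y])) := by
  have hm2 : m ∈ O.gz 2 := hm
  refine ⟨?_, fun h => ?_⟩
  · rw [O.brace_mm, sub_eq_zero]
  · have h0 : (O.bl (2, m) [(2, m)]).2 = 0 := by
      rw [O.bl_mm, O.brace_mm, h, sub_self]
    refine ⟨O.toB hm2 h0, fun n => O.gz_natCast n, fun z hz => O.gz_neg hz, ?_, ?_, ?_⟩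
    · intro p k q x y hx hy
      exact O.mu_apply p k x q y hx hy
    · intro a x hx
      have e1 := O.mu_apply 2 1 m ![a] ![x] hm (by simpa using hx)
      have e2 := O.mu_apply a 1 x ![2] ![m] hx (by simpa using hm)
      rw [← e1, ← e2]
      change O.dd m x = _
      simp only [NsOperad.dd, LinearMap.add_apply, LinearMap.comp_apply, LinearMap.flip_apply,
        O.sig_gz (a := (a : ℤ)) hx, map_smul, LinearMap.smul_apply]
      rw [O.b1_apply, O.b1_apply, sgn_add, sgn_one, mul_neg, mul_one, neg_smul, sub_neg_eq_add]
    · intro a b x y hx hy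
      have e1 := O.mu_apply 2 2 m ![a, b] ![x, y] hm (by
        intro l; fin_cases l
        · exact hx
        · exact hy)
      rw [← e1]
      change O.cup m x y = _
      simp only [NsOperad.cup, LinearMap.comp_apply,
        O.sig_gz (a := (a : ℤ)) hx, map_smul, LinearMap.smul_apply]
      rw [O.b2_apply]
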